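/- arXiv:1610.00935 — 4 statements merged into one kernel-verified Lean document; each statement's English description precedes it below -/
import Mathlib

section
/- Let k ≥ 4 be an integer and let H be a k-uniform hypergraph with at most ⌈(3/2)(k+1)⌉ edges. Then there exists a (k-2)-intersecting subset S ⊆ E(H) of edges such that the hypergraph H with the edges of S removed does not contain a copy of the tight path T^k_{2k}. -/
open scoped Classical

namespace ARR

/-- The vertex support of a hypergraph given by its edge set. -/
def vset (G : Finset (Finset ℕ)) : Finset ℕ := G.sup id

/-- Number of vertices of a hypergraph. -/
def vcount (G : Finset (Finset ℕ)) : ℕ := (vset G).card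

/-- `G` is a `k`-uniform hypergraph. -/
def IsUniform (k : ℕ) (G : Finset (Finset ℕ)) : Prop := ∀ e ∈ G, e.card = k

/-- The `k`-density `d_k`. -/
noncomputable def dk (k : ℕ) (G : Finset (Finset ℕ)) : ℝ :=
  if G.card = 0 then 0
  else if G.card = 1 ∧ vcount G = k then 1 / (k : ℝ)
  else ((G.card : ℝ) - 1) / ((vcount G : ℝ) - (k : ℝ))

/-- The `k`-density `m_k`: the maximum of `d_k` over subgraphs. -/
noncomputable def mk (k : ℕ) (G : Finset (Finset ℕ)) : ℝ :=
  sSup {x : ℝ | ∃ H ⊆ G, x = dk k H}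

/-- The usual density `m(G)`. -/
noncomputable def mDens (G : Finset (Finset ℕ)) : ℝ :=
  sSup {x : ℝ | ∃ H ⊆ G, 1 ≤ vcount H ∧ x = (H.card : ℝ) / (vcount H : ℝ)}

/-- `G` is strictly `k`-balanced: every proper subgraph has strictly smaller `k`-density. -/
def StrictlyKBalanced (k : ℕ) (G : Finset (Finset ℕ)) : Prop :=
  ∀ H ⊆ G, H ≠ G → dk k H < dk k G

/-- The asymmetric `k`-density `m_k(F₁,F₂)`. -/
noncomputable def mkA (k : ℕ) (F1 F2 : Finset (Finset ℕ)) : ℝ :=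
  sSup {x : ℝ | ∃ H ⊆ F1, H.Nonempty ∧
    x = (H.card : ℝ) / ((vcount H : ℝ) - (k : ℝ) + 1 / mk k F2)}

/-- `F₁` is strictly balanced with respect to `m_k(·, F₂)`. -/
def StrictlyBalancedWrt (k : ℕ) (F1 F2 : Finset (Finset ℕ)) : Prop :=
  ∀ H ⊆ F1, H.Nonempty → H ≠ F1 →
    (H.card : ℝ) / ((vcount H : ℝ) - (k : ℝ) + 1 / mk k F2) < mkA k F1 F2

/-- `F'` is a copy of `F` (an isomorphic image of `F`). -/
def IsCopy (F F' : Finset (Finset ℕ)) : Prop :=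
  ∃ f : ℕ → ℕ, Set.InjOn f ↑(vset F) ∧ F' = F.image (Finset.image f)

/-- `G` contains a copy of `F`. -/
def ContainsCopy (G F : Finset (Finset ℕ)) : Prop := ∃ F' ⊆ G, IsCopy F F'

/-- Asymmetric Ramsey arrow `G → (F₁, …, F_r)`. -/
def Arrow {r : ℕ} (G : Finset (Finset ℕ)) (F : Fin r → Finset (Finset ℕ)) : Prop :=
  ∀ χ : Finset ℕ → Fin r, ∃ i : Fin r, ∃ F' ⊆ G, IsCopy (F i) F' ∧ ∀ e ∈ F', χ e = i

/-- Symmetric Ramsey arrow `G → (F)_r`. -/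
def ArrowSym (G F : Finset (Finset ℕ)) (r : ℕ) : Prop :=
  ∀ χ : Finset ℕ → Fin r, ∃ i : Fin r, ∃ F' ⊆ G, IsCopy F F' ∧ ∀ e ∈ F', χ e = i

/-- Two-colour asymmetric arrow `G → (F₁, F₂)`. -/
def Arrow2 (G F1 F2 : Finset (Finset ℕ)) : Prop :=
  ∀ χ : Finset ℕ → Fin 2,
    (∃ F' ⊆ G, IsCopy F1 F' ∧ ∀ e ∈ F', χ e = 0) ∨
    (∃ F' ⊆ G, IsCopy F2 F' ∧ ∀ e ∈ F', χ e = 1)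

/-- The edge set of the complete `k`-uniform hypergraph on `{0, …, n-1}`. -/
def allEdges (k n : ℕ) : Finset (Finset ℕ) := (Finset.range n).powersetCard k

/-- Probability that the binomial random hypergraph `H^k(n,p)` satisfies property `P`. -/
noncomputable def prob (k n : ℕ) (p : ℝ) (P : Finset (Finset ℕ) → Prop) : ℝ :=
  ∑ G ∈ (allEdges k n).powerset,
    if P G then p ^ G.card * (1 - p) ^ ((allEdges k n).card - G.card) else 0

/-- Expected number of members of a family `𝓕` which appear as subgraphs of `H^k(n,p)`. -/
noncomputable def expectCount (k n : ℕ) (p : ℝ) (𝓕 : Finset (Finset (Finset ℕ))) : ℝ :=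
  ∑ G ∈ (allEdges k n).powerset,
    (p ^ G.card * (1 - p) ^ ((allEdges k n).card - G.card)) *
      ((𝓕.filter (fun F => F ⊆ G)).card : ℝ)

/-- `K₃^{+k}`: the triangle on `{0,1,2}` with the `k-2` vertices `{3,…,k}` added to each edge. -/
def K3plus (k : ℕ) : Finset (Finset ℕ) :=
  {({0, 1} : Finset ℕ) ∪ (Finset.range (k + 1)).filter (fun x => 3 ≤ x),
   ({0, 2} : Finset ℕ) ∪ (Finset.range (k + 1)).filter (fun x => 3 ≤ x),
   ({1, 2} : Finset ℕ) ∪ (Finset.range (k + 1)).filter (fun x => 3 ≤ x)}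

/-- The `i`-th edge `{i, i+1, …, i+k-1}` (mod `t`) of the tight cycle on `t` vertices. -/
def cycEdge (k t i : ℕ) : Finset ℕ := (Finset.range k).image (fun j => (i + j) % t)

/-- The tight cycle `C_t` (k-uniform) on vertex set `{0, …, t-1}`. -/
def tightCycle (k t : ℕ) : Finset (Finset ℕ) := (Finset.range t).image (cycEdge k t)

/-- The tight path `T^k_ℓ` on vertex set `{0, …, ℓ-1}`. -/
def tightPath (k l : ℕ) : Finset (Finset ℕ) :=
  (Finset.range (l - k + 1)).image (fun i => (Finset.range k).image (fun j => i + j))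

/-- The cycle length `t_k`: `t₄ = 8`, `t₅ = 14`, and `t_k = k²` for `k ≥ 6`. -/
def tk (k : ℕ) : ℕ := if k = 4 then 8 else if k = 5 then 14 else k ^ 2

/-- Shift all vertices of a hypergraph by `a` (used to form vertex-disjoint unions). -/
def shiftHG (a : ℕ) (G : Finset (Finset ℕ)) : Finset (Finset ℕ) :=
  G.image (Finset.image (· + a))

/-- A set of edges is `m`-intersecting if any two distinct edges meet in at most `m` vertices. -/
def IntersectingLE (m : ℕ) (S : Finset (Finset ℕ)) : Prop :=
  ∀ e ∈ S, ∀ f ∈ S, e ≠ f → (e ∩ f).card ≤ m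

/-- `e₀` is an attachment edge of `Fst` as a member of the family `F*(F₁,F₂)`. -/
def IsAttachment (F1 F2 Fst : Finset (Finset ℕ)) (e0 : Finset ℕ) : Prop :=
  ∃ F2' : Finset (Finset ℕ), e0 ∈ F2' ∧ IsCopy F2 F2' ∧
    ∃ g : Finset ℕ → Finset (Finset ℕ),
      (∀ e ∈ F2'.erase e0, IsCopy F1 (g e) ∧ e ∈ g e) ∧
      Fst = F2' ∪ (F2'.erase e0).biUnion g

/-- `Fst` is a member of the family `F*(F₁,F₂)`. -/
def IsFStar (F1 F2 Fst : Finset (Finset ℕ)) : Prop := ∃ e0, IsAttachment F1 F2 Fst e0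

/-- `Fst` is a generic member of `F*(F₁,F₂)`. -/
def IsGeneric (F1 F2 Fst : Finset (Finset ℕ)) : Prop :=
  ∃ F2' : Finset (Finset ℕ), ∃ e0 ∈ F2', IsCopy F2 F2' ∧
    ∃ g : Finset ℕ → Finset (Finset ℕ),
      (∀ e ∈ F2'.erase e0, IsCopy F1 (g e) ∧ e ∈ g e) ∧
      Fst = F2' ∪ (F2'.erase e0).biUnion g ∧
      (∀ e ∈ F2'.erase e0, vset (g e) ∩ vset F2' = e) ∧
      (∀ e ∈ F2'.erase e0, ∀ e' ∈ F2'.erase e0, e ≠ e' →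
        (vset (g e) \ e) ∩ (vset (g e') \ e') = ∅)

/-- The family `F*(F₁,F₂)` is asymmetric-balanced. -/
def AsymBalanced (k : ℕ) (F1 F2 : Finset (Finset ℕ)) : Prop :=
  ∀ Fst, IsFStar F1 F2 Fst →
    ∀ H ⊆ Fst, vset H ⊂ vset Fst → (∃ e0 ∈ H, IsAttachment F1 F2 Fst e0) →
      mkA k F1 F2 ≤ ((Fst.card : ℝ) - (H.card : ℝ)) / ((vcount Fst : ℝ) - (vcount H : ℝ)) ∧
      (((Fst.card : ℝ) - (H.card : ℝ)) / ((vcount Fst : ℝ) - (vcount H : ℝ)) = mkA k F1 F2 →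
        (∃ e0, IsAttachment F1 F2 Fst e0 ∧ H = {e0}) ∧ IsGeneric F1 F2 Fst)

/-- An edge `e` of `G` is closed (w.r.t. `F₁`, `F₂`): it lies in a copy of `F₁` and a copy
of `F₂` inside `G` whose edge sets intersect exactly in `{e}`. -/
def ClosedEdge (F1 F2 G : Finset (Finset ℕ)) (e : Finset ℕ) : Prop :=
  ∃ A ⊆ G, ∃ B ⊆ G, IsCopy F1 A ∧ IsCopy F2 B ∧ A ∩ B = {e}

/-- Every edge of `G` is closed within `G`. -/
def SelfClosed (F1 F2 G : Finset (Finset ℕ)) : Prop := ∀ e ∈ G, ClosedEdge F1 F2 G e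

/-- `Ĥ`: the subgraph of `H` obtained by repeatedly deleting open edges; equivalently the
largest subgraph of `H` all of whose edges are closed within it. -/
noncomputable def hatH (F1 F2 H : Finset (Finset ℕ)) : Finset (Finset ℕ) :=
  (H.powerset.filter (fun G => SelfClosed F1 F2 G)).sup id

/-- `G'` is an `(F₁,F₂)`-core of `Ĥ`. -/
def IsCore (F1 F2 H G' : Finset (Finset ℕ)) : Prop :=
  G' ⊆ hatH F1 F2 H ∧
    ∀ A ⊆ hatH F1 F2 H, (IsCopy F1 A ∨ IsCopy F2 A) → (A ⊆ G' ∨ A ∩ G' = ∅)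

/-- `G'` is a minimal (nonempty) closed `(F₁,F₂)`-core of `Ĥ`. -/
def IsMinimalCore (F1 F2 H G' : Finset (Finset ℕ)) : Prop :=
  G'.Nonempty ∧ IsCore F1 F2 H G' ∧
    ∀ G'' ⊆ G', G''.Nonempty → G'' ≠ G' → ¬ IsCore F1 F2 H G''


set_option maxHeartbeats 2000000 in
theorem aux_main {α : Type*} [DecidableEq α] (k : ℕ) (hk : 4 ≤ k) (H : Finset α) (D : α → α → ℕ)
    (hcard : H.card ≤ (3 * (k + 1) + 1) / 2)
    (h0 : ∀ x, D x x = 0)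
    (hs : ∀ x ∈ H, ∀ y ∈ H, D x y = D y x)
    (ht : ∀ x y z, D x z ≤ D x y + D y z)
    (hp : ∀ S ⊆ H, (∀ x ∈ S, ∀ y ∈ S, x ≠ y → D x y ≠ 1) →
      ∃ f : ℕ → α, (∀ i ≤ k, f i ∈ H \ S) ∧
        ∀ i ≤ k, ∀ j ≤ k, D (f i) (f j) = (i - j) + (j - i)) : False := by
  have inj : ∀ f : ℕ → α, (∀ i ≤ k, ∀ j ≤ k, D (f i) (f j) = (i - j) + (j - i)) →
      ∀ i ≤ k, ∀ j ≤ k, f i = f j → i = j := by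
    intro f hf i hi j hj h
    have h1 := hf i hi j hj
    rw [h, h0] at h1
    omega
  obtain ⟨e, he, hed⟩ := hp ∅ (by simp) (by simp)
  simp only [Finset.sdiff_empty] at he
  have einj := inj e hed
  set E0 := (Finset.range (k / 2 + 1)).image (fun i => e (2 * i)) with hE0
  set E1 := (Finset.range ((k + 1) / 2)).image (fun i => e (2 * i + 1)) with hE1
  have c0 : E0.card = k / 2 + 1 := by
    rw [hE0, Finset.card_image_of_injOn, Finset.card_range]
    intro a ha b hb hab
    simp only [Finset.coe_range, Set.mem_Iio] at ha hb
    have := einj _ (by omega) _ (by omega) hab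
    omega
  have c1 : E1.card = (k + 1) / 2 := by
    rw [hE1, Finset.card_image_of_injOn, Finset.card_range]
    intro a ha b hb hab
    simp only [Finset.coe_range, Set.mem_Iio] at ha hb
    have := einj _ (by omega) _ (by omega) hab
    omega
  have m0 : ∀ x, x ∈ E0 ↔ ∃ i ≤ k, i % 2 = 0 ∧ x = e i := by
    intro x
    simp only [hE0, Finset.mem_image, Finset.mem_range]
    constructor
    · rintro ⟨i, hi, rfl⟩
      exact ⟨2 * i, by omega, by omega, rfl⟩
    · rintro ⟨i, hi, h2, rfl⟩
      exact ⟨i / 2, by omega, by congr 1; omega⟩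
  have m1 : ∀ x, x ∈ E1 ↔ ∃ i ≤ k, i % 2 = 1 ∧ x = e i := by
    intro x
    simp only [hE1, Finset.mem_image, Finset.mem_range]
    constructor
    · rintro ⟨i, hi, rfl⟩
      exact ⟨2 * i + 1, by omega, by omega, rfl⟩
    · rintro ⟨i, hi, h2, rfl⟩
      exact ⟨i / 2, by omega, by congr 1; omega⟩
  have s0 : E0 ⊆ H := by
    intro x hx
    obtain ⟨i, hi, -, rfl⟩ := (m0 x).1 hx
    exact he i hi
  have s1 : E1 ⊆ H := by
    intro x hx
    obtain ⟨i, hi, -, rfl⟩ := (m1 x).1 hx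
    exact he i hi
  obtain ⟨q, hq, hqd⟩ := hp E0 s0 (by
    intro x hx y hy _
    obtain ⟨i, hi, hi2, rfl⟩ := (m0 x).1 hx
    obtain ⟨j, hj, hj2, rfl⟩ := (m0 y).1 hy
    rw [hed i hi j hj]
    omega)
  obtain ⟨r, hr, hrd⟩ := hp E1 s1 (by
    intro x hx y hy _
    obtain ⟨i, hi, hi2, rfl⟩ := (m1 x).1 hx
    obtain ⟨j, hj, hj2, rfl⟩ := (m1 y).1 hy
    rw [hed i hi j hj]
    omega)
  have qinj := inj q hqd
  have rinj := inj r hrd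
  have cimg : ∀ f : ℕ → α, (∀ i ≤ k, ∀ j ≤ k, f i = f j → i = j) →
      ((Finset.range (k + 1)).image f).card = k + 1 := by
    intro f hf
    rw [Finset.card_image_of_injOn, Finset.card_range]
    intro a ha b hb hab
    simp only [Finset.coe_range, Set.mem_Iio] at ha hb
    exact hf _ (by omega) _ (by omega) hab
  have d0 : (H \ E0).card = H.card - (k / 2 + 1) := by
    rw [Finset.card_sdiff_of_subset s0, c0]
  have d1 : (H \ E1).card = H.card - (k + 1) / 2 := by
    rw [Finset.card_sdiff_of_subset s1, c1]
  have qall : ∀ x ∈ H, x ∉ E0 → ∃ p ≤ k, q p = x := by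
    intro x hx hx0
    have hsub : (Finset.range (k + 1)).image q ⊆ H \ E0 := by
      intro y hy
      simp only [Finset.mem_image, Finset.mem_range] at hy
      obtain ⟨i, hi, rfl⟩ := hy
      exact hq i (by omega)
    have heq := Finset.eq_of_subset_of_card_le hsub (by rw [cimg q qinj, d0]; omega)
    have : x ∈ (Finset.range (k + 1)).image q := by
      rw [heq]; exact Finset.mem_sdiff.2 ⟨hx, hx0⟩
    simp only [Finset.mem_image, Finset.mem_range] at this
    obtain ⟨i, hi, h⟩ := this
    exact ⟨i, by omega, h⟩
  set R := (Finset.range (k + 1)).image r with hR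
  have mR : ∀ x, x ∈ R ↔ ∃ p ≤ k, r p = x := by
    intro x
    simp [hR]
  have rsub : R ⊆ H \ E1 := by
    intro y hy
    obtain ⟨i, hi, rfl⟩ := (mR y).1 hy
    exact hr i hi
  have cm : ((H \ E1) \ R).card ≤ 1 ∧ (k % 2 = 1 → ((H \ E1) \ R).card = 0) := by
    rw [Finset.card_sdiff_of_subset rsub, d1, hR, cimg r rinj]
    omega
  have emem : ∀ i ≤ k, i % 2 = 0 → e i ∈ H \ E1 := by
    intro i hi h2
    refine Finset.mem_sdiff.2 ⟨he i hi, fun h => ?_⟩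
    obtain ⟨j, hj, hj2, h⟩ := (m1 _).1 h
    have := einj _ hi _ hj h
    omega
  have eodd : ∀ i ≤ k, i % 2 = 1 → ∃ p ≤ k, q p = e i := by
    intro i hi h2
    refine qall _ (he i hi) (fun h => ?_)
    obtain ⟨j, hj, hj2, h⟩ := (m0 _).1 h
    have := einj _ hi _ hj h
    omega
  -- the key claim
  have key : ∀ a ≤ k, ∀ b ≤ k, ∀ c ≤ k, ∀ d ≤ k, a % 2 = 0 → b % 2 = 1 → c % 2 = 0 → d % 2 = 1 →
      ((b = a + 1 ∧ c = a + 2 ∧ d = a + 3) ∨ (a = d + 3 ∧ b = d + 2 ∧ c = d + 1)) →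
      e a ∈ R → e c ∈ R → False := by
    intro a ha b hb c hc d hd a2 b2 c2 d2 habcd hea hec
    obtain ⟨p, hp', hpa⟩ := (mR _).1 hea
    obtain ⟨s, hs', hsc⟩ := (mR _).1 hec
    have hps := hrd p hp' s hs'
    rw [hpa, hsc, hed a ha c hc] at hps
    obtain ⟨t, ht', htp, hts⟩ : ∃ t ≤ k, (p - t) + (t - p) = 1 ∧ (t - s) + (s - t) = 1 :=
      ⟨(p + s) / 2, by omega, by omega, by omega⟩
    have hxH := Finset.mem_sdiff.1 (hr t ht')
    have D1 := hrd p hp' t ht'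
    have D2 := hrd t ht' s hs'
    rw [htp, hpa] at D1
    rw [hts, hsc] at D2
    have hx0 : r t ∉ E0 := by
      intro h
      obtain ⟨j, hj, hj2, h⟩ := (m0 _).1 h
      rw [h, hed a ha j hj] at D1
      omega
    obtain ⟨u, hu, hux⟩ := qall _ hxH.1 hx0
    obtain ⟨v, hv, hvb⟩ := eodd b hb b2
    obtain ⟨w, hw, hwd⟩ := eodd d hd d2
    rw [← hux] at D1 D2
    have t1 := ht (e a) (q u) (e d)
    have t2 := ht (q u) (e c) (e d)
    have t3 := ht (q u) (e c) (e b)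
    rw [hed a ha d hd] at t1
    rw [hed c hc d hd] at t2
    rw [hed c hc b hb] at t3
    rw [← hwd, hqd u hu w hw] at t1 t2
    rw [← hvb, hqd u hu v hv] at t3
    have t4 := hqd v hv w hw
    rw [hvb, hwd, hed b hb d hd] at t4
    have huv : u = v := by omega
    apply hxH.2
    rw [← hux, huv, hvb]
    exact (m1 _).2 ⟨b, hb, b2, rfl⟩
  have miss : ∀ x ∈ H \ E1, ∀ y ∈ H \ E1, x ∉ R → y ∉ R → x = y := by
    intro x hx y hy hxR hyR
    exact Finset.card_le_one.1 cm.1 x (Finset.mem_sdiff.2 ⟨hx, hxR⟩) y (Finset.mem_sdiff.2 ⟨hy, hyR⟩)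
  have k1 := key 0 (by omega) 1 (by omega) 2 (by omega) 3 (by omega) rfl rfl rfl rfl (by omega)
  rcases Nat.mod_two_eq_zero_or_one k with hk2 | hk2
  swap
  · have hz := Finset.card_eq_zero.1 (cm.2 hk2)
    have hall : ∀ x ∈ H \ E1, x ∈ R := by
      intro x hx
      by_contra h
      have : x ∈ (H \ E1) \ R := Finset.mem_sdiff.2 ⟨hx, h⟩
      rw [hz] at this
      simp at this
    exact k1 (hall _ (emem 0 (by omega) rfl)) (hall _ (emem 2 (by omega) rfl))
  have k2 := key k le_rfl (k - 1) (by omega) (k - 2) (by omega) (k - 3) (by omega)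
    hk2 (by omega) (by omega) (by omega) (by omega)
  have hab : ∃ i, (i = 0 ∨ i = 2) ∧ e i ∉ R := by
    by_contra hcon
    push Not at hcon
    exact k1 (hcon 0 (by simp)) (hcon 2 (by simp))
  have hcd : ∃ i, (i = k ∨ i = k - 2) ∧ e i ∉ R := by
    by_contra hcon
    push Not at hcon
    exact k2 (hcon k (by simp)) (hcon (k - 2) (by simp))
  obtain ⟨i, hi, hiR⟩ := hab
  obtain ⟨j, hj, hjR⟩ := hcd
  have hij := einj i (by omega) j (by omega)
    (miss _ (emem i (by omega) (by omega)) _ (emem j (by omega) (by omega)) hiR hjR)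
  have hk4 : k = 4 := by omega
  have hi2 : i = 2 := by omega
  subst hi2
  subst hk4
  have inR : ∀ x ∈ H \ E1, x ≠ e 2 → x ∈ R := by
    intro x hx hne
    by_contra h
    exact hne (miss _ hx _ (emem 2 (by omega) rfl) h hiR)
  obtain ⟨p0, hp0, h0'⟩ := (mR _).1 (inR _ (emem 0 (by omega) rfl)
    (fun h => by have := einj _ (by omega) _ (by omega) h; omega))
  obtain ⟨p4, hp4, h4'⟩ := (mR _).1 (inR _ (emem 4 (by omega) rfl)
    (fun h => by have := einj _ (by omega) _ (by omega) h; omega))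
  have h04 := hrd p0 hp0 p4 hp4
  rw [h0', h4', hed 0 (by omega) 4 (by omega)] at h04
  obtain ⟨a, ha, ha1⟩ := eodd 1 (by omega) rfl
  obtain ⟨b, hb, hb3⟩ := eodd 3 (by omega) rfl
  have hab' := hqd a ha b hb
  rw [ha1, hb3, hed 1 (by omega) 3 (by omega)] at hab'
  have pos : ∀ p ≤ 4, p ≠ a → p ≠ b → ∃ s, 1 ≤ s ∧ s ≤ 3 ∧ r s = q p := by
    intro p hp' hpa hpb
    have hqp := Finset.mem_sdiff.1 (hq p hp')
    have hne : ∀ i ≤ 4, i % 2 = 0 → q p ≠ e i := fun i hi hi2 h => hqp.2 ((m0 _).2 ⟨i, hi, hi2, h⟩)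
    have h1 : q p ∉ E1 := by
      intro h
      obtain ⟨i, hi, hi2, h⟩ := (m1 _).1 h
      have : i = 1 ∨ i = 3 := by omega
      rcases this with rfl | rfl
      · exact hpa (qinj _ hp' _ ha (h.trans ha1.symm))
      · exact hpb (qinj _ hp' _ hb (h.trans hb3.symm))
    obtain ⟨s, hs', hsp⟩ := (mR _).1 (inR (q p) (Finset.mem_sdiff.2 ⟨hqp.1, h1⟩) (hne 2 (by omega) rfl))
    have hs0 : s ≠ p0 := by
      rintro rfl
      exact hne 0 (by omega) rfl (hsp.symm.trans h0')
    have hs4 : s ≠ p4 := by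
      rintro rfl
      exact hne 4 (by omega) rfl (hsp.symm.trans h4')
    exact ⟨s, by omega, by omega, hsp⟩
  have close : ∀ p ≤ 4, ∀ p' ≤ 4, p ≠ a → p ≠ b → p' ≠ a → p' ≠ b → p' ≤ p + 2 := by
    intro p hp1 p' hp2 g1 g2 g3 g4
    obtain ⟨s, hs1, hs3, hsq⟩ := pos p hp1 g1 g2
    obtain ⟨s', hs1', hs3', hsq'⟩ := pos p' hp2 g3 g4
    have := hrd s (by omega) s' (by omega)
    rw [hsq, hsq', hqd p hp1 p' hp2] at this
    omega
  have z1 := close 0 (by omega) 4 (by omega)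
  have z2 := close 1 (by omega) 4 (by omega)
  have z3 := close 0 (by omega) 3 (by omega)
  omega

theorem aux_copy (k : ℕ) (G : Finset (Finset ℕ)) (h : ContainsCopy G (tightPath k (2 * k))) :
    ∃ f : ℕ → Finset ℕ, (∀ i ≤ k, f i ∈ G) ∧
      ∀ i ≤ k, ∀ j ≤ k, (f i \ f j).card = (i - j) + (j - i) := by
  obtain ⟨F', hF', g, hg, rfl⟩ := h
  have himg : ∀ i, (Finset.range k).image (fun j => i + j) = Finset.Ico i (i + k) := by
    intro i
    ext x
    simp only [Finset.mem_image, Finset.mem_range, Finset.mem_Ico]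
    constructor
    · rintro ⟨a, ha, rfl⟩; omega
    · rintro ⟨h1, h2⟩; exact ⟨x - i, by omega, by omega⟩
  have hmem : ∀ i ≤ k, Finset.Ico i (i + k) ∈ tightPath k (2 * k) := by
    intro i hi
    rw [tightPath, Finset.mem_image]
    exact ⟨i, by rw [Finset.mem_range]; omega, himg i⟩
  have hsub : ∀ i ≤ k, Finset.Ico i (i + k) ⊆ vset (tightPath k (2 * k)) := by
    intro i hi
    exact Finset.le_sup (f := id) (hmem i hi)
  refine ⟨fun i => (Finset.Ico i (i + k)).image g, ?_, ?_⟩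
  · intro i hi
    exact hF' (Finset.mem_image_of_mem _ (hmem i hi))
  · intro i hi j hj
    have e1 : (Finset.Ico i (i + k)).image g \ (Finset.Ico j (j + k)).image g
        = (Finset.Ico i (i + k) \ Finset.Ico j (j + k)).image g := by
      ext y
      simp only [Finset.mem_sdiff, Finset.mem_image]
      constructor
      · rintro ⟨⟨x, hx, rfl⟩, hn⟩
        exact ⟨x, ⟨hx, fun hxj => hn ⟨x, hxj, rfl⟩⟩, rfl⟩
      · rintro ⟨x, ⟨hx, hxj⟩, rfl⟩
        refine ⟨⟨x, hx, rfl⟩, ?_⟩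
        rintro ⟨x', hx', hxx⟩
        have := hg (hsub j hj hx') (hsub i hi hx) hxx
        exact hxj (this ▸ hx')
    show ((Finset.Ico i (i + k)).image g \ (Finset.Ico j (j + k)).image g).card = _
    rw [e1, Finset.card_image_of_injOn]
    · rcases le_total i j with hij | hij
      · have : Finset.Ico i (i + k) \ Finset.Ico j (j + k) = Finset.Ico i j := by
          ext x; simp only [Finset.mem_sdiff, Finset.mem_Ico]; omega
        rw [this, Nat.card_Ico]; omega
      · have : Finset.Ico i (i + k) \ Finset.Ico j (j + k) = Finset.Ico (j + k) (i + k) := by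
          ext x; simp only [Finset.mem_sdiff, Finset.mem_Ico]; omega
        rw [this, Nat.card_Ico]; omega
    · intro x hx y hy hxy
      exact hg (hsub i hi (Finset.mem_sdiff.1 hx).1) (hsub i hi (Finset.mem_sdiff.1 hy).1) hxy

/-- every `k`-uniform hypergraph with at most `⌈3(k+1)/2⌉` edges has a
`(k-2)`-intersecting edge set whose removal destroys all copies of `T^k_{2k}`. -/
theorem rdo_lge5 (k : ℕ) (hk : 4 ≤ k) (H : Finset (Finset ℕ))
    (hu : IsUniform k H) (hcard : H.card ≤ (3 * (k + 1) + 1) / 2) :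
    ∃ S ⊆ H, IntersectingLE (k - 2) S ∧
      ¬ ContainsCopy (H \ S) (tightPath k (2 * k)) := by
  by_contra hcon
  push Not at hcon
  refine aux_main k hk H (fun x y => (x \ y).card) hcard (by simp) ?_ ?_ ?_
  · intro x hx y hy
    exact Finset.card_sdiff_comm ((hu x hx).trans (hu y hy).symm)
  · intro x y z
    refine (Finset.card_le_card ?_).trans (Finset.card_union_le (x \ y) (y \ z))
    intro a
    simp only [Finset.mem_sdiff, Finset.mem_union]
    tauto
  · intro S hS hind
    have hI : IntersectingLE (k - 2) S := by
      intro x hx y hy hne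
      have h1 := hind x hx y hy hne
      have h2 := Finset.card_inter_add_card_sdiff x y
      rw [hu x (hS hx)] at h2
      have h3 : (x \ y).card ≠ 0 := by
        intro h
        rw [Finset.card_eq_zero, Finset.sdiff_eq_empty_iff_subset] at h
        exact hne (Finset.eq_of_subset_of_card_le h (by rw [hu x (hS hx), hu y (hS hy)]))
      omega
    obtain ⟨f, h1, h2⟩ := aux_copy k _ (hcon S hS hI)
    refine ⟨f, fun i hi => ?_, fun i hi j hj => ?_⟩
    · convert h1 i hi
    · rw [← h2 i hi j hj]

end ARR
end

section
/- Let H be a 3-uniform hypergraph with 7 edges. Then there exists a 1-intersecting subset S ⊆ E(H) of edges such that the hypergraph H with the edges of S removed does not contain a copy of the tight path T^3_6. -/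
open scoped Classical

namespace ARR

/-- conjunction, reducing fast in the kernel -/
noncomputable def band (a b : Bool) : Bool := @Bool.rec (fun _ => Bool) false b a

/-- `¬ a ∨ b`, reducing fast in the kernel -/
noncomputable def bimp (a b : Bool) : Bool := @Bool.rec (fun _ => Bool) true b a

/-- `a ∨ b`, reducing fast in the kernel -/
noncomputable def bor (a b : Bool) : Bool := @Bool.rec (fun _ => Bool) b true a

noncomputable def lany (L : List ℕ) (f : ℕ → Bool) : Bool :=
  @List.rec ℕ (fun _ => Bool) false (fun a _ ih => bor (f a) ih) L

noncomputable def lall (L : List ℕ) (f : ℕ → Bool) : Bool :=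
  @List.rec ℕ (fun _ => Bool) true (fun a _ ih => band (f a) ih) L

/-- all members of `L` other than `a`, `b` satisfy `f` -/
noncomputable def lallx (a b : ℕ) (L : List ℕ) (f : ℕ → Bool) : Bool :=
  lall L fun m => bor (Nat.beq m a) (bor (Nat.beq m b) (f m))

/-- bitmask test: `a` and `b` share at most one vertex -/
noncomputable def nadj (a b : ℕ) : Bool :=
  Nat.beq (Nat.land (Nat.land a b) (Nat.sub (Nat.land a b) 1)) 0

/-- there is no walk with disjoint ends avoiding `a`, `b` -/
noncomputable def nowalk (a b : ℕ) (L : List ℕ) : Bool :=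
  lallx a b L fun p => lallx a b L fun s => bimp (Nat.beq (Nat.land p s) 0) <|
    lallx a b L fun q => bor (nadj p q) <|
      lallx a b L fun r => bor (nadj r s) (nadj q r)

/-- there is no walk with disjoint ends -/
noncomputable def nwk (L : List ℕ) : Bool :=
  lall L fun p => lall L fun s => bimp (Nat.beq (Nat.land p s) 0) <|
    lall L fun q => bor (nadj p q) <|
      lall L fun r => bor (nadj r s) (nadj q r)

/-- there is a pair whose removal kills all walks -/
noncomputable def goodB (L : List ℕ) : Bool :=
  lany L fun a => lany L fun b => band (nadj a b) (nowalk a b L)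

/-- masks of the triples in `{0,…,8}` -/
def trips : List ℕ := [7, 11, 13, 14, 19, 21, 22, 25, 26, 28, 35, 37, 38, 41, 42, 44, 49, 50, 52, 56, 67, 69, 70, 73, 74, 76, 81, 82, 84, 88, 97, 98, 100, 104, 112, 131, 133, 134, 137, 138, 140, 145, 146, 148, 152, 161, 162, 164, 168, 176, 193, 194, 196, 200, 208, 224, 259, 261, 262, 265, 266, 268, 273, 274, 276, 280, 289, 290, 292, 296, 304, 321, 322, 324, 328, 336, 352, 385, 386, 388, 392, 400, 416, 448]

/-- number of labels used after adding the mask `x` -/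
noncomputable def nxt (x n : ℕ) : ℕ :=
  @Bool.rec (fun _ => ℕ) n (Nat.succ n) (Nat.ble (Nat.pow 2 n) x)

noncomputable def checkZ (x y n : ℕ) : Bool :=
  band (goodB [7, 28, 56, 14, x, y]) <| lall trips fun z =>
    bimp (Nat.ble (Nat.succ z) (Nat.pow 2 (Nat.succ n))) <|
      bor (lall [7, 14, 28, 56, x, y] fun a => nadj a z) <|
      bor (lany [7, 14, 28, 56, x, y] fun a => Nat.beq a z) <|
      bor (nwk [56, 14, x, y, z]) <| goodB [7, 28, 56, 14, x, y, z]

noncomputable def checkY (x n : ℕ) : Bool :=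
  lall trips fun y =>
    bimp (Nat.ble (Nat.succ y) (Nat.pow 2 (Nat.succ n))) <|
      bor (lall [14, 28, x] fun a => nadj a y) <|
      bor (lany [7, 14, 28, 56, x] fun a => Nat.beq a y) <|
      checkZ x y (nxt y n)

noncomputable def checkX : Bool :=
  lall trips fun x =>
    bimp (Nat.ble (Nat.succ x) 128) <| bor (lall [14, 28] fun a => nadj a x) <|
      bor (lany [7, 14, 28, 56] fun a => Nat.beq a x) <| checkY x (nxt x 6)

set_option maxRecDepth 100000 in
theorem checkX_true : checkX = true := by decide +kernel

theorem band_iff (a b : Bool) : band a b = true ↔ a = true ∧ b = true := by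
  cases a <;> cases b <;> simp [band]

theorem bimp_iff (a b : Bool) : bimp a b = true ↔ (a = true → b = true) := by
  cases a <;> cases b <;> simp [bimp]

theorem bor_iff (a b : Bool) : bor a b = true ↔ a = true ∨ b = true := by
  cases a <;> cases b <;> simp [bor]

theorem lany_iff (L : List ℕ) (f : ℕ → Bool) : lany L f = true ↔ ∃ a ∈ L, f a = true := by
  induction L with
  | nil => simp [lany]
  | cons a L ih =>
    have : lany (a :: L) f = bor (f a) (lany L f) := rfl
    rw [this, bor_iff, ih]; simp

theorem lall_iff (L : List ℕ) (f : ℕ → Bool) : lall L f = true ↔ ∀ a ∈ L, f a = true := by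
  induction L with
  | nil => simp [lall]
  | cons a L ih =>
    have : lall (a :: L) f = band (f a) (lall L f) := rfl
    rw [this, band_iff, ih]; simp

theorem lallx_iff (a b : ℕ) (L : List ℕ) (f : ℕ → Bool) :
    lallx a b L f = true ↔ ∀ m ∈ L, m ≠ a → m ≠ b → f m = true := by
  simp only [lallx, lall_iff, bor_iff, Nat.beq_eq]
  refine forall₂_congr fun m _ => ?_
  tauto

/-- the vertex set coded by a mask -/
def dec (m : ℕ) : Finset ℕ := (Finset.range 9).filter fun i => m.testBit i = true

/-- the edge coded by a mask, via the labelling `σ` -/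
def edge (σ : ℕ → ℕ) (m : ℕ) : Finset ℕ := (dec m).image σ

theorem dec_land (a b : ℕ) : dec (Nat.land a b) = dec a ∩ dec b := by
  ext i
  have : Nat.land a b = a &&& b := rfl
  simp only [dec, this, Finset.mem_filter, Finset.mem_inter, Nat.testBit_and, Bool.and_eq_true]
  tauto

set_option maxRecDepth 100000 in
theorem dec_table : ∀ c < 512, ((Nat.beq (Nat.land c (Nat.sub c 1)) 0 = true ↔ (dec c).card ≤ 1) ∧
    (Nat.beq c 0 = true ↔ (dec c).card = 0)) ∧ ((dec c).card = 3 → c ∈ trips) := by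
  decide +kernel

set_option maxRecDepth 100000 in
theorem trips_lt : ∀ c ∈ trips, c < 512 := by decide +kernel

theorem land_lt {a : ℕ} (b : ℕ) (ha : a < 512) : Nat.land a b < 512 :=
  lt_of_le_of_lt Nat.and_le_left ha

theorem edge_inter {σ : ℕ → ℕ} (hσ : Function.Injective σ) (a b : ℕ) :
    (edge σ a ∩ edge σ b).card = (dec (Nat.land a b)).card := by
  rw [edge, edge, ← Finset.image_inter _ _ hσ, Finset.card_image_of_injective _ hσ, dec_land]

theorem nadj_iff {σ : ℕ → ℕ} (hσ : Function.Injective σ) {a : ℕ} (b : ℕ) (ha : a < 512) :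
    nadj a b = true ↔ (edge σ a ∩ edge σ b).card ≤ 1 := by
  rw [edge_inter hσ, nadj]; exact (dec_table _ (land_lt b ha)).1.1

theorem disj_iff {σ : ℕ → ℕ} (hσ : Function.Injective σ) {a : ℕ} (b : ℕ) (ha : a < 512) :
    Nat.beq (Nat.land a b) 0 = true ↔ (edge σ a ∩ edge σ b).card = 0 := by
  rw [edge_inter hσ]; exact (dec_table _ (land_lt b ha)).1.2

/-- no walk with disjoint ends -/
def NoWalk (G : Finset (Finset ℕ)) : Prop :=
  ∀ p ∈ G, ∀ q ∈ G, ∀ r ∈ G, ∀ s ∈ G, 2 ≤ (p ∩ q).card → 2 ≤ (q ∩ r).card → 2 ≤ (r ∩ s).card →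
    (p ∩ s).card = 0 → False

theorem meet {p q s : Finset ℕ} (hq : q.card = 3) (h1 : 2 ≤ (p ∩ q).card) (h2 : 2 ≤ (q ∩ s).card)
    (h : (p ∩ s).card = 0) : False := by
  have hd : Disjoint (p ∩ q) (q ∩ s) := by
    rw [Finset.disjoint_left]
    intro v hv hv'
    have : v ∈ p ∩ s := by simp at *; tauto
    rw [Finset.card_eq_zero] at h
    simp [h] at this
  have h3 : (p ∩ q ∪ q ∩ s).card ≤ q.card := Finset.card_le_card (by
    intro v; simp; tauto)
  rw [Finset.card_union_of_disjoint hd] at h3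
  omega

theorem distinct {p q r s : Finset ℕ} (hp : p.card = 3) (hq : q.card = 3) (hr : r.card = 3)
    (hs : s.card = 3)
    (h1 : 2 ≤ (p ∩ q).card) (h2 : 2 ≤ (q ∩ r).card) (h3 : 2 ≤ (r ∩ s).card)
    (h : (p ∩ s).card = 0) : p ≠ q ∧ p ≠ r ∧ p ≠ s ∧ q ≠ r ∧ q ≠ s ∧ r ≠ s := by
  refine ⟨?_, ?_, ?_, ?_, ?_, ?_⟩
  · rintro rfl; exact meet hr h2 h3 h
  · rintro rfl; omega
  · rintro rfl; simp at h; simp [h] at hp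
  · rintro rfl; exact meet hq h1 h3 h
  · rintro rfl; omega
  · rintro rfl; exact meet hq h1 h2 h

theorem cross {A B G : Finset (Finset ℕ)} (hA : A.card ≤ 3) (hB : B.card ≤ 3) (hG : G ⊆ A ∪ B)
    (hu : IsUniform 3 G) (hw : ¬ NoWalk G) : ∃ a ∈ A, ∃ b ∈ B, 2 ≤ (a ∩ b).card := by
  unfold NoWalk at hw
  push Not at hw
  obtain ⟨p, hp, q, hq, r, hr, s, hs, h1, h2, h3, h, -⟩ := hw
  obtain ⟨d1, d2, d3, d4, d5, d6⟩ :=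
    distinct (hu p hp) (hu q hq) (hu r hr) (hu s hs) h1 h2 h3 h
  have hc : ({p, q, r, s} : Finset (Finset ℕ)).card = 4 := by
    simp [Finset.card_insert_of_notMem, d1, d2, d3, d4, d5, d6]
  have key : ∀ C : Finset (Finset ℕ), C.card ≤ 3 → ¬ (p ∈ C ∧ q ∈ C ∧ r ∈ C ∧ s ∈ C) := by
    rintro C hC ⟨c1, c2, c3, c4⟩
    have : ({p, q, r, s} : Finset (Finset ℕ)) ⊆ C := by
      intro v; simp; rintro (rfl | rfl | rfl | rfl) <;> assumption
    have := Finset.card_le_card this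
    omega
  have kA := key A hA
  have kB := key B hB
  have gp := Finset.mem_union.1 (hG hp)
  have gq := Finset.mem_union.1 (hG hq)
  have gr := Finset.mem_union.1 (hG hr)
  have gs := Finset.mem_union.1 (hG hs)
  by_contra hno
  push Not at hno
  have n1 : ∀ a b : Finset ℕ, 2 ≤ (a ∩ b).card → (a ∈ A ∨ a ∈ B) → (b ∈ A ∨ b ∈ B) →
      (a ∈ A → b ∈ A) ∧ (a ∈ B → b ∈ B) := by
    intro a b hab ha hb
    have hab' := hab
    rw [Finset.inter_comm] at hab'
    constructor
    · intro ha'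
      rcases hb with hb | hb
      · exact hb
      · have := hno a ha' b hb; omega
    · intro ha'
      rcases hb with hb | hb
      · have := hno b hb a ha'; omega
      · exact hb
  have m1 := n1 p q h1 gp gq
  have m2 := n1 q r h2 gq gr
  have m3 := n1 r s h3 gr gs
  rcases gp with gp | gp
  · exact kA ⟨gp, m1.1 gp, m2.1 (m1.1 gp), m3.1 (m2.1 (m1.1 gp))⟩
  · exact kB ⟨gp, m1.2 gp, m2.2 (m1.2 gp), m3.2 (m2.2 (m1.2 gp))⟩

theorem good_of_list {H : Finset (Finset ℕ)} (hu : IsUniform 3 H) {σ : ℕ → ℕ}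
    (hσ : Function.Injective σ) {L : List ℕ} (hL : ∀ m ∈ L, m < 512) (hg : goodB L = true)
    (hLH : ∀ m ∈ L, edge σ m ∈ H)
    (hH : ∀ h ∈ H, (∃ m ∈ L, h = edge σ m) ∨ ∀ h' ∈ H, h' ≠ h → (h ∩ h').card ≤ 1) :
    ∃ e ∈ H, ∃ f ∈ H, (e ∩ f).card ≤ 1 ∧ NoWalk (H \ {e, f}) := by
  rw [goodB, lany_iff] at hg
  obtain ⟨a, ha, hg⟩ := hg
  rw [lany_iff] at hg
  obtain ⟨b, hb, hg⟩ := hg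
  rw [band_iff, nadj_iff hσ b (hL a ha)] at hg
  refine ⟨edge σ a, hLH a ha, edge σ b, hLH b hb, hg.1, ?_⟩
  have hw := hg.2
  simp only [nowalk, lallx_iff, bimp_iff, bor_iff] at hw
  intro p hp q hq r hr s hs h1 h2 h3 h
  simp only [Finset.mem_sdiff, Finset.mem_insert, Finset.mem_singleton, not_or] at hp hq hr hs
  obtain ⟨d1, d2, d3, d4, d5, d6⟩ :=
    distinct (hu p hp.1) (hu q hq.1) (hu r hr.1) (hu s hs.1) h1 h2 h3 h
  have get : ∀ u v : Finset ℕ, u ∈ H → v ∈ H → v ≠ u → 2 ≤ (u ∩ v).card →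
      ∃ m ∈ L, u = edge σ m := by
    intro u v hu' hv hne h2'
    rcases hH u hu' with hm | hm
    · exact hm
    · have := hm v hv hne; omega
  obtain ⟨p, hpL, rfl⟩ := get p q hp.1 hq.1 d1.symm h1
  obtain ⟨q, hqL, rfl⟩ := get q r hq.1 hr.1 d4.symm h2
  obtain ⟨r, hrL, rfl⟩ := get r s hr.1 hs.1 d6.symm h3
  obtain ⟨s, hsL, rfl⟩ := get s _ hs.1 hr.1 d6 (by rw [Finset.inter_comm]; exact h3)
  have ne : ∀ m c : ℕ, edge σ m ≠ edge σ c → m ≠ c := by rintro m c hmc rfl; exact hmc rfl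
  have := hw p hpL (ne _ _ hp.2.1) (ne _ _ hp.2.2) s hsL (ne _ _ hs.2.1) (ne _ _ hs.2.2)
    ((disj_iff hσ s (hL p hpL)).2 h) q hqL (ne _ _ hq.2.1) (ne _ _ hq.2.2)
  rw [nadj_iff hσ q (hL p hpL)] at this
  rcases this with this | this
  · omega
  have := this r hrL (ne _ _ hr.2.1) (ne _ _ hr.2.2)
  rw [nadj_iff hσ s (hL r hrL), nadj_iff hσ r (hL q hqL)] at this
  omega

theorem extend_inj (g : ℕ → ℕ) (n : ℕ) (hg : Set.InjOn g (Set.Iio n)) :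
    ∃ σ : ℕ → ℕ, Function.Injective σ ∧ ∀ i < n, σ i = g i := by
  let M := (Finset.range n).sup g + 1
  have hM : ∀ i < n, g i < M := fun i hi =>
    Nat.lt_succ_of_le (Finset.le_sup (f := g) (Finset.mem_range.2 hi))
  refine ⟨fun i => if i < n then g i else i + M, ?_, fun i hi => by simp [hi]⟩
  intro i j hij
  simp only at hij
  split_ifs at hij with hi hj hj
  · exact hg hi hj hij
  · have := hM i hi; omega
  · have := hM j hj; omega
  · omega

theorem dec_lt {m n i : ℕ} (hm : m < 2 ^ n) (hi : i ∈ dec m) : i < n := by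
  by_contra hin
  have : m < 2 ^ i := lt_of_lt_of_le hm (Nat.pow_le_pow_right (by norm_num) (by omega))
  simp [dec, Nat.testBit_lt_two_pow this] at hi

theorem edge_congr {σ τ : ℕ → ℕ} {m n : ℕ} (hm : m < 2 ^ n) (h : ∀ i < n, τ i = σ i) :
    edge τ m = edge σ m :=
  Finset.image_congr fun i hi => h i (dec_lt hm (by simpa using hi))

theorem exists_mask (t : Finset ℕ) (n : ℕ) (hn : n ≤ 9) (ht : t ⊆ Finset.range n) :
    ∃ m < 2 ^ n, dec m = t := by
  refine ⟨∑ i ∈ t, 2 ^ i, ?_, ?_⟩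
  · calc ∑ i ∈ t, 2 ^ i ≤ ∑ i ∈ Finset.range n, 2 ^ i :=
        Finset.sum_le_sum_of_subset ht
      _ < 2 ^ n := Nat.geomSum_lt (by norm_num) (by simp)
  · ext i
    have h1 : i ∈ t → i < 9 := fun h => by have := Finset.mem_range.1 (ht h); omega
    have h2 : (∑ i ∈ t, 2 ^ i).testBit i = true ↔ i ∈ t := by
      rw [← Nat.mem_bitIndices, ← List.mem_toFinset, Finset.toFinset_bitIndices_sum_two_pow]
    simp only [dec, Finset.mem_filter, Finset.mem_range, h2]
    tauto

theorem step {σ : ℕ → ℕ} (hσ : Function.Injective σ) {n m : ℕ} (hn : n ≤ 8) (hm : m < 2 ^ n)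
    {x : Finset ℕ} (hx : x.card = 3) (hadj : 2 ≤ (edge σ m ∩ x).card) :
    ∃ τ : ℕ → ℕ, Function.Injective τ ∧ (∀ i < n, τ i = σ i) ∧
      ∃ k ∈ trips, k < 2 ^ (n + 1) ∧ x = edge τ k := by
  have hxs : (x \ (Finset.range n).image σ).card ≤ 1 := by
    have h1 : edge σ m ∩ x ⊆ x ∩ (Finset.range n).image σ := by
      intro v hv
      rw [Finset.mem_inter] at hv
      refine Finset.mem_inter.2 ⟨hv.2, ?_⟩
      obtain ⟨i, hi, rfl⟩ := Finset.mem_image.1 hv.1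
      exact Finset.mem_image_of_mem _ (Finset.mem_range.2 (dec_lt hm hi))
    have h2 := Finset.card_le_card h1
    have h3 := Finset.card_sdiff_add_card_inter x ((Finset.range n).image σ)
    omega
  have main : ∃ τ : ℕ → ℕ, Function.Injective τ ∧ (∀ i < n, τ i = σ i) ∧
      x ⊆ (Finset.range (n + 1)).image τ := by
    rcases (x \ (Finset.range n).image σ).eq_empty_or_nonempty with he | ⟨v, hv⟩
    · refine ⟨σ, hσ, fun _ _ => rfl, (Finset.sdiff_eq_empty_iff_subset.1 he).trans ?_⟩
      exact Finset.image_subset_image (Finset.range_subset_range.2 (by omega))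
    · have hv' := (Finset.mem_sdiff.1 hv).2
      have hvn : ∀ i < n, σ i ≠ v := fun i hi h =>
        hv' (Finset.mem_image.2 ⟨i, Finset.mem_range.2 hi, h⟩)
      obtain ⟨τ, hτ, hτg⟩ := extend_inj (Function.update σ n v) (n + 1) (by
        intro i hi j hj hij
        simp only [Set.mem_Iio] at hi hj
        simp only [Function.update_apply] at hij
        split_ifs at hij with h1 h2 h2
        · omega
        · exact absurd hij.symm (hvn j (by omega))
        · exact absurd hij (hvn i (by omega))
        · exact hσ hij)
      refine ⟨τ, hτ, fun i hi => ?_, fun w hw => ?_⟩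
      · rw [hτg i (by omega), Function.update_of_ne (by omega)]
      · by_cases hwi : w ∈ (Finset.range n).image σ
        · obtain ⟨i, hi, rfl⟩ := Finset.mem_image.1 hwi
          rw [Finset.mem_range] at hi
          refine Finset.mem_image.2 ⟨i, Finset.mem_range.2 (by omega), ?_⟩
          rw [hτg i (by omega), Function.update_of_ne (by omega)]
        · have : w = v := Finset.card_le_one.1 hxs w (Finset.mem_sdiff.2 ⟨hw, hwi⟩) v hv
          refine Finset.mem_image.2 ⟨n, Finset.mem_range.2 (by omega), ?_⟩
          rw [hτg n (by omega), this]; simp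
  obtain ⟨τ, hτ, hag, hsub⟩ := main
  obtain ⟨t, ht, rfl⟩ := Finset.subset_image_iff.1 hsub
  obtain ⟨k, hk, rfl⟩ := exists_mask t (n + 1) (by omega) (by exact_mod_cast ht)
  refine ⟨τ, hτ, hag, k, ?_, hk, rfl⟩
  have hk' : k < 512 := lt_of_lt_of_le hk
    (le_trans (Nat.pow_le_pow_right (by norm_num) (by omega : n + 1 ≤ 9)) (by norm_num))
  refine (dec_table k hk').2 ?_
  rwa [Finset.card_image_of_injective _ hτ] at hx

theorem nxt_spec {y n : ℕ} (hy : y < 2 ^ (n + 1)) : n ≤ nxt y n ∧ nxt y n ≤ n + 1 ∧ y < 2 ^ nxt y n := by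
  have hp : Nat.pow 2 n = 2 ^ n := rfl
  unfold nxt
  cases h : Nat.ble (Nat.pow 2 n) y with
  | true => exact ⟨Nat.le_succ n, le_refl _, hy⟩
  | false =>
    refine ⟨le_refl n, Nat.le_succ n, ?_⟩
    by_contra hcon
    rw [hp] at h
    have := Nat.ble_eq_true_of_le (not_lt.1 hcon)
    rw [this] at h; cases h

/-- the conclusion we aim for -/
def Good (H : Finset (Finset ℕ)) : Prop :=
  ∃ e ∈ H, ∃ f ∈ H, (e ∩ f).card ≤ 1 ∧ NoWalk (H \ {e, f})

theorem lt512 {m n : ℕ} (hn : n ≤ 9) (hm : m < 2 ^ n) : m < 512 :=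
  lt_of_lt_of_le hm (le_trans (Nat.pow_le_pow_right (by norm_num) hn) (by norm_num))

theorem mem7 (x y k m : ℕ) :
    m ∈ [7, 28, 56, 14, x, y, k] ↔ m ∈ [7, 14, 28, 56, x, y] ∨ m = k := by
  simp only [List.mem_cons, List.not_mem_nil, or_false]; omega

theorem mem6p (x y m : ℕ) : m ∈ [7, 28, 56, 14, x, y] ↔ m ∈ [7, 14, 28, 56, x, y] := by
  simp only [List.mem_cons, List.not_mem_nil, or_false]; omega

theorem mem6 (x k m : ℕ) : m ∈ [7, 14, 28, 56, x, k] ↔ m ∈ [7, 14, 28, 56, x] ∨ m = k := by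
  simp only [List.mem_cons, List.not_mem_nil, or_false]; omega

theorem mem5 (k m : ℕ) : m ∈ [7, 14, 28, 56, k] ↔ m ∈ [7, 14, 28, 56] ∨ m = k := by
  simp only [List.mem_cons, List.not_mem_nil, or_false]; omega

theorem mem3 (x m : ℕ) : m ∈ [14, 28, x] → m ∈ [7, 14, 28, 56, x] := by
  simp only [List.mem_cons, List.not_mem_nil, or_false]; omega

theorem mem2 (m : ℕ) : m ∈ [14, 28] → m ∈ [7, 14, 28, 56] := by
  simp only [List.mem_cons, List.not_mem_nil, or_false]; omega

theorem mem23 (x m : ℕ) : m ∈ [14, 28] → m ∈ [14, 28, x] := by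
  simp only [List.mem_cons, List.not_mem_nil, or_false]; omega

theorem fast {x y z : ℕ}
    (h : bor (nwk [56, 14, x, y, z]) (goodB [7, 28, 56, 14, x, y, z]) = true) :
    goodB [7, 28, 56, 14, x, y, z] = true := by
  rw [bor_iff] at h
  rcases h with h | h
  · have key : ∀ m ∈ [7, 28, 56, 14, x, y, z], m ≠ 7 → m ≠ 28 → m ∈ [56, 14, x, y, z] := by
      intro m hm h1 h2
      simpa [h1, h2] using hm
    rw [goodB, lany_iff]
    refine ⟨7, by simp, ?_⟩
    rw [lany_iff]
    refine ⟨28, by simp, ?_⟩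
    rw [band_iff]
    refine ⟨by decide +kernel, ?_⟩
    simp only [nwk, lall_iff, bimp_iff, bor_iff] at h
    simp only [nowalk, lallx_iff, bimp_iff, bor_iff]
    intro p hp p1 p2 s hs s1 s2 hps q hq q1 q2
    rcases h p (key p hp p1 p2) s (key s hs s1 s2) hps q (key q hq q1 q2) with h | h
    · exact Or.inl h
    · exact Or.inr fun r hr r1 r2 => h r (key r hr r1 r2)
  · exact h

theorem mainZ {H : Finset (Finset ℕ)} (hu : IsUniform 3 H) {σ : ℕ → ℕ}
    (hσ : Function.Injective σ) {x y n : ℕ} (hn : n ≤ 8)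
    (hlt : ∀ m ∈ [7, 14, 28, 56, x, y], m < 2 ^ n)
    (hin : ∀ m ∈ [7, 14, 28, 56, x, y], edge σ m ∈ H) {z : Finset ℕ} (hz : z ∈ H)
    (hzn : ∀ m ∈ [7, 14, 28, 56, x, y], z ≠ edge σ m)
    (hall : ∀ h ∈ H, h = z ∨ ∃ m ∈ [7, 14, 28, 56, x, y], h = edge σ m)
    (hc : checkZ x y n = true) : Good H := by
  have perm : ∀ m, m ∈ [7, 28, 56, 14, x, y] ↔ m ∈ [7, 14, 28, 56, x, y] := mem6p x y
  rw [checkZ, band_iff, lall_iff] at hc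
  by_cases hex : ∃ m ∈ [7, 14, 28, 56, x, y], 2 ≤ (edge σ m ∩ z).card
  · obtain ⟨m, hm, hmz⟩ := hex
    obtain ⟨τ, hτ, hag, k, hkt, hk, rfl⟩ := step hσ hn (hlt m hm) (hu z hz) hmz
    have he : ∀ m ∈ [7, 14, 28, 56, x, y], edge τ m = edge σ m :=
      fun m hm => edge_congr (hlt m hm) hag
    have h2 := hc.2 k hkt
    rw [bimp_iff, bor_iff, bor_iff, lall_iff, lany_iff] at h2
    have h3 := h2 (Nat.ble_eq_true_of_le hk)
    have hl : ∀ m ∈ [7, 14, 28, 56, x, y], m < 512 := fun m hm => lt512 (by omega) (hlt m hm)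
    rcases h3 with h3 | ⟨a, ha, h3⟩ | h3
    · have := (nadj_iff hτ k (hl m hm)).1 (h3 m hm)
      rw [he m hm] at this
      omega
    · rw [Nat.beq_eq] at h3
      subst h3
      exact absurd (he a ha) (hzn a ha)
    · have h3 := fast h3
      have hmem : ∀ m, m ∈ [7, 28, 56, 14, x, y, k] ↔ m ∈ [7, 14, 28, 56, x, y] ∨ m = k := mem7 x y k
      refine good_of_list hu hτ (L := [7, 28, 56, 14, x, y, k]) ?_ h3 ?_ ?_
      · intro m hm
        rcases (hmem m).1 hm with hm | rfl
        · exact hl m hm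
        · exact lt512 (by omega) hk
      · intro m hm
        rcases (hmem m).1 hm with hm | rfl
        · rw [he m hm]; exact hin m hm
        · exact hz
      · intro h hh
        left
        rcases hall h hh with rfl | ⟨m, hm, rfl⟩
        · exact ⟨k, (hmem k).2 (Or.inr rfl), rfl⟩
        · exact ⟨m, (hmem m).2 (Or.inl hm), (he m hm).symm⟩
  · push Not at hex
    refine good_of_list hu hσ (L := [7, 28, 56, 14, x, y]) ?_ hc.1 ?_ ?_
    · intro m hm
      exact lt512 (by omega) (hlt m ((perm m).1 hm))
    · intro m hm
      exact hin m ((perm m).1 hm)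
    · intro h hh
      rcases hall h hh with rfl | ⟨m, hm, rfl⟩
      · right
        intro h' hh' hne
        rcases hall h' hh' with rfl | ⟨m, hm, rfl⟩
        · exact absurd rfl hne
        · have := hex m hm
          rw [Finset.inter_comm] at this
          omega
      · left
        exact ⟨m, (perm m).2 hm, rfl⟩

theorem mainY {H : Finset (Finset ℕ)} (hu : IsUniform 3 H) {σ : ℕ → ℕ}
    (hσ : Function.Injective σ) {x n : ℕ} (hn : n ≤ 7)
    (hlt : ∀ m ∈ [7, 14, 28, 56, x], m < 2 ^ n)
    (hin : ∀ m ∈ [7, 14, 28, 56, x], edge σ m ∈ H) {y z : Finset ℕ} (hy : y ∈ H) (hz : z ∈ H)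
    (hyz : z ≠ y)
    (hyn : ∀ m ∈ [7, 14, 28, 56, x], y ≠ edge σ m)
    (hzn : ∀ m ∈ [7, 14, 28, 56, x], z ≠ edge σ m)
    (hall : ∀ h ∈ H, h = y ∨ h = z ∨ ∃ m ∈ [7, 14, 28, 56, x], h = edge σ m)
    (hadj : ∃ m ∈ [14, 28, x], 2 ≤ (edge σ m ∩ y).card)
    (hc : checkY x n = true) : Good H := by
  obtain ⟨m, hm, hmy⟩ := hadj
  have hm' : ∀ m ∈ [14, 28, x], m ∈ [7, 14, 28, 56, x] := mem3 x
  obtain ⟨τ, hτ, hag, k, hkt, hk, rfl⟩ := step hσ (by omega) (hlt m (hm' m hm)) (hu y hy) hmy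
  have he : ∀ m ∈ [7, 14, 28, 56, x], edge τ m = edge σ m :=
    fun m hm => edge_congr (hlt m hm) hag
  rw [checkY, lall_iff] at hc
  have h2 := hc k hkt
  rw [bimp_iff, bor_iff, bor_iff, lall_iff, lany_iff] at h2
  have h3 := h2 (Nat.ble_eq_true_of_le hk)
  have hmem : ∀ m, m ∈ [7, 14, 28, 56, x, k] ↔ m ∈ [7, 14, 28, 56, x] ∨ m = k := mem6 x k
  obtain ⟨n1, n2, n3⟩ := nxt_spec hk
  rcases h3 with h3 | ⟨a, ha, h3⟩ | h3
  · have := (nadj_iff hτ k (lt512 (by omega) (hlt m (hm' m hm)))).1 (h3 m hm)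
    rw [he m (hm' m hm)] at this
    omega
  · rw [Nat.beq_eq] at h3
    subst h3
    exact absurd (he a ha) (hyn a ha)
  · refine mainZ hu hτ (by omega) ?_ ?_ hz ?_ ?_ h3
    · intro m hm
      rcases (hmem m).1 hm with hm | rfl
      · exact lt_of_lt_of_le (hlt m hm) (Nat.pow_le_pow_right (by norm_num) n1)
      · exact n3
    · intro m hm
      rcases (hmem m).1 hm with hm | rfl
      · rw [he m hm]; exact hin m hm
      · exact hy
    · intro m hm
      rcases (hmem m).1 hm with hm | rfl
      · rw [he m hm]; exact hzn m hm
      · exact hyz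
    · intro h hh
      rcases hall h hh with rfl | rfl | ⟨m, hm, rfl⟩
      · exact Or.inr ⟨k, (hmem k).2 (Or.inr rfl), rfl⟩
      · exact Or.inl rfl
      · exact Or.inr ⟨m, (hmem m).2 (Or.inl hm), (he m hm).symm⟩

theorem mainX {H : Finset (Finset ℕ)} (hu : IsUniform 3 H) {σ : ℕ → ℕ}
    (hσ : Function.Injective σ)
    (hin : ∀ m ∈ [7, 14, 28, 56], edge σ m ∈ H) {x y z : Finset ℕ} (hx : x ∈ H)
    (hy : y ∈ H) (hz : z ∈ H) (hxy : y ≠ x) (hxz : z ≠ x) (hyz : z ≠ y)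
    (hxn : ∀ m ∈ [7, 14, 28, 56], x ≠ edge σ m)
    (hyn : ∀ m ∈ [7, 14, 28, 56], y ≠ edge σ m)
    (hzn : ∀ m ∈ [7, 14, 28, 56], z ≠ edge σ m)
    (hall : ∀ h ∈ H, h = x ∨ h = y ∨ h = z ∨ ∃ m ∈ [7, 14, 28, 56], h = edge σ m)
    (hadj : ∃ m ∈ [14, 28], 2 ≤ (edge σ m ∩ x).card)
    (hadj2 : (∃ m ∈ [14, 28], 2 ≤ (edge σ m ∩ y).card) ∨ 2 ≤ (x ∩ y).card) : Good H := by
  have hc := checkX_true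
  have hlt : ∀ m ∈ [7, 14, 28, 56], m < 2 ^ 6 := by decide
  obtain ⟨m, hm, hmy⟩ := hadj
  have hm' : ∀ m ∈ [14, 28], m ∈ [7, 14, 28, 56] := mem2
  obtain ⟨τ, hτ, hag, k, hkt, hk, rfl⟩ := step hσ (by omega) (hlt m (hm' m hm)) (hu x hx) hmy
  have he : ∀ m ∈ [7, 14, 28, 56], edge τ m = edge σ m :=
    fun m hm => edge_congr (hlt m hm) hag
  rw [checkX, lall_iff] at hc
  have h2 := hc k hkt
  rw [bimp_iff, bor_iff, bor_iff, lall_iff, lany_iff] at h2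
  have h3 := h2 (Nat.ble_eq_true_of_le hk)
  have hmem : ∀ m, m ∈ [7, 14, 28, 56, k] ↔ m ∈ [7, 14, 28, 56] ∨ m = k := mem5 k
  obtain ⟨n1, n2, n3⟩ := nxt_spec hk
  rcases h3 with h3 | ⟨a, ha, h3⟩ | h3
  · have := (nadj_iff hτ k (lt512 (by omega) (hlt m (hm' m hm)))).1 (h3 m hm)
    rw [he m (hm' m hm)] at this
    omega
  · rw [Nat.beq_eq] at h3
    subst h3
    exact absurd (he a ha) (hxn a ha)
  · refine mainY hu hτ (by omega) ?_ ?_ hy hz hyz ?_ ?_ ?_ ?_ h3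
    · intro m hm
      rcases (hmem m).1 hm with hm | rfl
      · exact lt_of_lt_of_le (hlt m hm) (Nat.pow_le_pow_right (by norm_num) n1)
      · exact n3
    · intro m hm
      rcases (hmem m).1 hm with hm | rfl
      · rw [he m hm]; exact hin m hm
      · exact hx
    · intro m hm
      rcases (hmem m).1 hm with hm | rfl
      · rw [he m hm]; exact hyn m hm
      · exact hxy
    · intro m hm
      rcases (hmem m).1 hm with hm | rfl
      · rw [he m hm]; exact hzn m hm
      · exact hxz
    · intro h hh
      rcases hall h hh with rfl | rfl | rfl | ⟨m, hm, rfl⟩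
      · exact Or.inr (Or.inr ⟨k, (hmem k).2 (Or.inr rfl), rfl⟩)
      · exact Or.inl rfl
      · exact Or.inr (Or.inl rfl)
      · exact Or.inr (Or.inr ⟨m, (hmem m).2 (Or.inl hm), (he m hm).symm⟩)
    · rcases hadj2 with ⟨m, hm, h⟩ | h
      · refine ⟨m, mem23 k m hm, ?_⟩
        rw [he m (hm' m hm)]; exact h
      · exact ⟨k, by simp, h⟩

theorem vset_path : ∀ i < 6, i ∈ vset (tightPath 3 6) := by decide

theorem dec_path : ∀ m ∈ [7, 14, 28, 56], dec m ∈ tightPath 3 6 := by decide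

theorem copy_spec {G : Finset (Finset ℕ)} (h : ContainsCopy G (tightPath 3 6)) :
    ∃ σ : ℕ → ℕ, Function.Injective σ ∧ ∀ m ∈ [7, 14, 28, 56], edge σ m ∈ G := by
  obtain ⟨F, hF, f, hf, rfl⟩ := h
  obtain ⟨σ, hσ, hag⟩ := extend_inj f 6 (hf.mono fun i hi => vset_path i hi)
  refine ⟨σ, hσ, fun m hm => ?_⟩
  have hlt : ∀ m ∈ [7, 14, 28, 56], m < 2 ^ 6 := by decide
  rw [edge_congr (hlt m hm) hag]
  exact hF (Finset.mem_image_of_mem _ (dec_path m hm))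

theorem no_copy {G : Finset (Finset ℕ)} (h : NoWalk G) : ¬ ContainsCopy G (tightPath 3 6) := by
  intro hc
  obtain ⟨σ, hσ, hm⟩ := copy_spec hc
  refine h _ (hm 7 (by simp)) _ (hm 14 (by simp)) _ (hm 28 (by simp)) _ (hm 56 (by simp))
    ?_ ?_ ?_ ?_ <;> rw [edge_inter hσ] <;> decide

theorem good_of_copy {H : Finset (Finset ℕ)} (hu : IsUniform 3 H) (hcard : H.card = 7)
    (h : ContainsCopy H (tightPath 3 6)) : Good H := by
  obtain ⟨σ, hσ, hin⟩ := copy_spec h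
  by_contra hbad
  have hw : ¬ NoWalk (H \ {edge σ 7, edge σ 56}) := by
    intro hw
    refine hbad ⟨_, hin 7 (by simp), _, hin 56 (by simp), ?_, hw⟩
    rw [edge_inter hσ]; decide
  have hu' : IsUniform 3 (H \ {edge σ 7, edge σ 56}) :=
    fun e he => hu e (Finset.mem_sdiff.1 he).1
  obtain ⟨T, hT⟩ : ∃ T, T = H \ ({7, 14, 28, 56} : Finset ℕ).image (edge σ) := ⟨_, rfl⟩
  have hTm : ∀ t, t ∈ T ↔ t ∈ H ∧ ∀ m ∈ [7, 14, 28, 56], t ≠ edge σ m := by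
    intro t
    rw [hT]
    simp
  have hTc : T.card = 3 := by
    rw [hT, Finset.card_sdiff_of_subset, Finset.card_image_of_injOn, hcard]
    · rfl
    · intro a ha b hb hab
      have hd : dec a = dec b := Finset.image_injective hσ hab
      have : ∀ a ∈ ({7, 14, 28, 56} : Finset ℕ), ∀ b ∈ ({7, 14, 28, 56} : Finset ℕ),
        dec a = dec b → a = b := by decide
      exact this a ha b hb hd
    · intro e he
      obtain ⟨m, hm, rfl⟩ := Finset.mem_image.1 he
      exact hin m (by simpa using hm)
  have hHT : ∀ h ∈ H, h ∈ T ∨ ∃ m ∈ [7, 14, 28, 56], h = edge σ m := by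
    intro h hh
    rw [hTm]
    by_cases hm : ∃ m ∈ [7, 14, 28, 56], h = edge σ m
    · exact Or.inr hm
    · push Not at hm
      exact Or.inl ⟨hh, hm⟩
  have hGT : ∀ h ∈ H \ {edge σ 7, edge σ 56}, h ∈ T ∨ h = edge σ 14 ∨ h = edge σ 28 := by
    intro h hh
    rw [Finset.mem_sdiff] at hh
    simp only [Finset.mem_insert, Finset.mem_singleton, not_or] at hh
    rcases hHT h hh.1 with h1 | ⟨m, hm, rfl⟩
    · exact Or.inl h1
    · simp only [List.mem_cons, List.not_mem_nil, or_false] at hm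
      rcases hm with rfl | rfl | rfl | rfl
      · exact absurd rfl hh.2.1
      · simp
      · simp
      · exact absurd rfl hh.2.2
  obtain ⟨a, ha, x, hx, hax⟩ := cross (A := {edge σ 14, edge σ 28}) (B := T)
    (Finset.card_le_two.trans (by norm_num)) hTc.le (fun h hh => by
      have := hGT h hh
      simp only [Finset.mem_union, Finset.mem_insert, Finset.mem_singleton]; tauto) hu' hw
  obtain ⟨b, hb, y, hy, hby⟩ := cross (A := {edge σ 14, edge σ 28, x}) (B := T.erase x)
    Finset.card_le_three (by rw [Finset.card_erase_of_mem hx]; omega) (fun h hh => by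
      have := hGT h hh
      simp only [Finset.mem_union, Finset.mem_insert, Finset.mem_singleton, Finset.mem_erase]
      tauto) hu' hw
  have hc1 : ((T.erase x).erase y).card = 1 := by
    rw [Finset.card_erase_of_mem hy, Finset.card_erase_of_mem hx]; omega
  obtain ⟨z, hz⟩ := Finset.card_eq_one.1 hc1
  have hz' : z ∈ (T.erase x).erase y := by rw [hz]; simp
  simp only [Finset.mem_erase] at hz' hy
  have hx' := (hTm x).1 hx
  have hy' := (hTm y).1 hy.2
  have hz'' := (hTm z).1 hz'.2.2
  refine hbad (mainX hu hσ hin hx'.1 hy'.1 hz''.1 hy.1 hz'.2.1 hz'.1 hx'.2 hy'.2 hz''.2 ?_ ?_ ?_)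
  · intro h hh
    rcases hHT h hh with h1 | h1
    · by_cases e1 : h = x
      · exact Or.inl e1
      by_cases e2 : h = y
      · exact Or.inr (Or.inl e2)
      have : h ∈ (T.erase x).erase y := by simp [e1, e2, h1]
      rw [hz, Finset.mem_singleton] at this
      exact Or.inr (Or.inr (Or.inl this))
    · exact Or.inr (Or.inr (Or.inr h1))
  · simp only [Finset.mem_insert, Finset.mem_singleton] at ha
    rcases ha with rfl | rfl
    · exact ⟨14, by simp, hax⟩
    · exact ⟨28, by simp, hax⟩
  · simp only [Finset.mem_insert, Finset.mem_singleton] at hb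
    rcases hb with rfl | rfl | rfl
    · exact Or.inl ⟨14, by simp, hby⟩
    · exact Or.inl ⟨28, by simp, hby⟩
    · exact Or.inr hby

/-- every 3-uniform hypergraph with 7 edges has a 1-intersecting edge set
whose removal destroys all copies of `T³₆`. -/
theorem rdo_l4 (H : Finset (Finset ℕ)) (hu : IsUniform 3 H) (hcard : H.card = 7) :
    ∃ S ⊆ H, IntersectingLE 1 S ∧ ¬ ContainsCopy (H \ S) (tightPath 3 6) := by
  by_cases hc : ContainsCopy H (tightPath 3 6)
  · obtain ⟨e, he, f, hf, hef, hw⟩ := good_of_copy hu hcard hc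
    refine ⟨{e, f}, ?_, ?_, no_copy hw⟩
    · intro g hg
      simp only [Finset.mem_insert, Finset.mem_singleton] at hg
      rcases hg with rfl | rfl <;> assumption
    · intro g hg k hk hne
      simp only [Finset.mem_insert, Finset.mem_singleton] at hg hk
      rcases hg with rfl | rfl <;> rcases hk with rfl | rfl
      · exact absurd rfl hne
      · exact hef
      · rw [Finset.inter_comm]; exact hef
      · exact absurd rfl hne
  · exact ⟨∅, by simp, by intro e he; simp at he, by simpa using hc⟩

end ARR
end

section
/- Let k ≥ 3 and let a_0, a_1 be two distinct edges of the tight path T^k_{2k} with m := |a_0 ∩ a_1| ≥ 1. Then there exist k-m-1 distinct edges e_1, …, e_{k-m-1} ∈ E(T^k_{2k}) \ {a_0, a_1} such that for each i ∈ {1, …, k-m-1}: |e_i ∩ a_0 ∩ a_1| = m, |e_i ∩ (a_0 \ a_1)| = i, and |e_i ∩ (a_1 \ a_0)| = k-m-i. Moreover, for each edge e' ∈ E(T^k_{2k}) \ {a_0, a_1, e_1, …, e_{k-m-1}} there exists b ∈ {0,1} such that |e' ∩ a_0 ∩ a_1| ≤ m-1, |e' ∩ (a_b \ a_{1-b})|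 = 0, and |e' ∩ (a_{1-b} \ a_b)| = k-m. -/
open scoped Classical

namespace ARR

theorem aux_mem (k : ℕ) (e : Finset ℕ) :
    e ∈ tightPath k (2 * k) ↔ ∃ s, s ≤ k ∧ e = Finset.Ico s (s + k) := by
  have key : ∀ s : ℕ, (Finset.range k).image (fun j => s + j) = Finset.Ico s (s + k) := by
    intro s
    ext x
    simp only [Finset.mem_image, Finset.mem_range, Finset.mem_Ico]
    constructor
    · rintro ⟨j, hj, rfl⟩
      omega
    · intro h
      exact ⟨x - s, by omega, by omega⟩
  simp only [tightPath, Finset.mem_image, Finset.mem_range, key]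
  constructor
  · rintro ⟨s, hs, rfl⟩
    exact ⟨s, by omega, rfl⟩
  · rintro ⟨s, hs, rfl⟩
    exact ⟨s, by omega, rfl⟩

theorem aux_eq (k s p : ℕ) (hk : 3 ≤ k) :
    Finset.Ico s (s + k) = Finset.Ico p (p + k) ↔ s = p := by
  constructor
  · intro h
    have h1 : s ∈ Finset.Ico p (p + k) := by rw [← h]; simp; omega
    have h2 : p ∈ Finset.Ico s (s + k) := by rw [h]; simp; omega
    simp only [Finset.mem_Ico] at h1 h2
    omega
  · rintro rfl
    rfl

theorem aux_three (k s p q : ℕ) :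
    (Finset.Ico s (s + k) ∩ Finset.Ico p (p + k) ∩ Finset.Ico q (q + k)).card
      = min (min s p + k) (q + k) - max (max s p) q := by
  have : Finset.Ico s (s + k) ∩ Finset.Ico p (p + k) ∩ Finset.Ico q (q + k)
      = Finset.Ico (max (max s p) q) (min (min s p + k) (q + k)) := by
    ext x
    simp only [Finset.mem_inter, Finset.mem_Ico]
    omega
  rw [this, Nat.card_Ico]

theorem aux_two (k p q : ℕ) :
    (Finset.Ico p (p + k) ∩ Finset.Ico q (q + k)).card = min p q + k - max p q := by
  have : Finset.Ico p (p + k) ∩ Finset.Ico q (q + k)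
      = Finset.Ico (max p q) (min p q + k) := by
    ext x
    simp only [Finset.mem_inter, Finset.mem_Ico]
    omega
  rw [this, Nat.card_Ico]

theorem aux_left (k s p q : ℕ) (h : p ≤ q) :
    (Finset.Ico s (s + k) ∩ (Finset.Ico p (p + k) \ Finset.Ico q (q + k))).card
      = min (s + k) (min q (p + k)) - max s p := by
  have : Finset.Ico s (s + k) ∩ (Finset.Ico p (p + k) \ Finset.Ico q (q + k))
      = Finset.Ico (max s p) (min (s + k) (min q (p + k))) := by
    ext x
    simp only [Finset.mem_inter, Finset.mem_sdiff, Finset.mem_Ico]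
    omega
  rw [this, Nat.card_Ico]

theorem aux_right (k s p q : ℕ) (h : q ≤ p) (h' : p ≤ q + k) :
    (Finset.Ico s (s + k) ∩ (Finset.Ico p (p + k) \ Finset.Ico q (q + k))).card
      = min s p + k - max s (q + k) := by
  have : Finset.Ico s (s + k) ∩ (Finset.Ico p (p + k) \ Finset.Ico q (q + k))
      = Finset.Ico (max s (q + k)) (min s p + k) := by
    ext x
    simp only [Finset.mem_inter, Finset.mem_sdiff, Finset.mem_Ico]
    omega
  rw [this, Nat.card_Ico]

/-- the structure of the edges of the tight path `T^k_{2k}` relative to two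
fixed edges `a₀, a₁` intersecting in `m ≥ 1` vertices. -/
theorem core_l_r (k : ℕ) (hk : 3 ≤ k) (a0 a1 : Finset ℕ)
    (h0 : a0 ∈ tightPath k (2 * k)) (h1 : a1 ∈ tightPath k (2 * k)) (hne : a0 ≠ a1)
    (m : ℕ) (hm : m = (a0 ∩ a1).card) (hm1 : 1 ≤ m) :
    ∃ E : ℕ → Finset ℕ,
      (∀ i : ℕ, 1 ≤ i → i ≤ k - m - 1 →
        E i ∈ tightPath k (2 * k) ∧ E i ≠ a0 ∧ E i ≠ a1 ∧
        (E i ∩ a0 ∩ a1).card = m ∧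
        (E i ∩ (a0 \ a1)).card = i ∧
        (E i ∩ (a1 \ a0)).card = k - m - i) ∧
      (∀ i j : ℕ, 1 ≤ i → i ≤ k - m - 1 → 1 ≤ j → j ≤ k - m - 1 → i ≠ j → E i ≠ E j) ∧
      (∀ e' ∈ tightPath k (2 * k), e' ≠ a0 → e' ≠ a1 →
        (∀ i : ℕ, 1 ≤ i → i ≤ k - m - 1 → e' ≠ E i) →
        (e' ∩ a0 ∩ a1).card ≤ m - 1 ∧
          (((e' ∩ (a0 \ a1)).card = 0 ∧ (e' ∩ (a1 \ a0)).card = k - m) ∨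
           ((e' ∩ (a1 \ a0)).card = 0 ∧ (e' ∩ (a0 \ a1)).card = k - m))) := by
  obtain ⟨p, hp, rfl⟩ := (aux_mem k _).1 h0
  obtain ⟨q, hq, rfl⟩ := (aux_mem k _).1 h1
  rw [ne_eq, aux_eq k _ _ hk] at hne
  rw [aux_two] at hm
  rcases lt_or_gt_of_ne hne with h | h
  · have hl := fun s => aux_left k s p q h.le
    have hr := fun s => aux_right k s q p h.le (by omega)
    refine ⟨fun i => Finset.Ico (q - i) (q - i + k), ?_, ?_, ?_⟩
    · intro i hi1 hi2
      simp only [ne_eq, aux_eq k _ _ hk, aux_three, hl, hr]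
      refine ⟨(aux_mem k _).2 ⟨q - i, by omega, rfl⟩, ?_⟩
      omega
    · intro i j hi1 hi2 hj1 hj2 hij
      simp only [ne_eq, aux_eq k _ _ hk]
      omega
    · intro e' he' hn0 hn1 hE
      obtain ⟨s, hs, rfl⟩ := (aux_mem k _).1 he'
      simp only [ne_eq, aux_eq k _ _ hk] at hn0 hn1 hE
      simp only [aux_three, hl, hr]
      have hE' := hE (q - s)
      omega
  · have hl := fun s => aux_right k s p q h.le (by omega)
    have hr := fun s => aux_left k s q p h.le
    refine ⟨fun i => Finset.Ico (q + i) (q + i + k), ?_, ?_, ?_⟩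
    · intro i hi1 hi2
      simp only [ne_eq, aux_eq k _ _ hk, aux_three, hl, hr]
      refine ⟨(aux_mem k _).2 ⟨q + i, by omega, rfl⟩, ?_⟩
      omega
    · intro i j hi1 hi2 hj1 hj2 hij
      simp only [ne_eq, aux_eq k _ _ hk]
      omega
    · intro e' he' hn0 hn1 hE
      obtain ⟨s, hs, rfl⟩ := (aux_mem k _).1 he'
      simp only [ne_eq, aux_eq k _ _ hk] at hn0 hn1 hE
      simp only [aux_three, hl, hr]
      have hE' := hE (s - q)
      omega

end ARR
end

section
/- For every k ≥ 4, the family F*(K_3^{+k}, C_{t_k}) is asymmetric-balanced; that is, for every F* ∈ F*(K_3^{+k}, C_{t_k}) and every subgraph H ⊊ F* with V(H) ⊊ V(F*) that contains an attachment edge of F*, one has (e(F*) - e(H))/(v(F*) - v(H)) ≥ m_k(K_3^{+k}, C_{t_k}), and if equality holds then H consists of exactly an attachment edge and F* is generic. -/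
open scoped Classical

namespace ARR

/-- windows hitting W -/
def PW (k : ℕ) (W : Finset ℕ) : Finset ℕ := W.biUnion (fun b => Finset.Icc (b+1-k) b)
/-- windows hitting W in one place -/
noncomputable def P1W (k : ℕ) (W : Finset ℕ) : Finset ℕ :=
  (PW k W).filter (fun j => ∃ b, ∀ i ∈ W, j ≤ i → i < j + k → i = b)

lemma mem_PW {k : ℕ} {W : Finset ℕ} {j : ℕ} : j ∈ PW k W ↔ ∃ b ∈ W, b + 1 - k ≤ j ∧ j ≤ b := by
  simp [PW]

lemma mem_P1W {k : ℕ} {W : Finset ℕ} {j : ℕ} : j ∈ P1W k W ↔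
    (∃ b ∈ W, b + 1 - k ≤ j ∧ j ≤ b) ∧ ∃ b, ∀ i ∈ W, j ≤ i → i < j + k → i = b := by
  simp [P1W, mem_PW]

lemma PW_insert {k M M' : ℕ} {s : Finset ℕ} (hM' : M' ∈ s) (hmax : ∀ i ∈ s, i ≤ M') (h : M' < M) :
    (PW k (insert M s)).card = (PW k s).card + (Finset.Icc (max (M'+1) (M+1-k)) M).card := by
  rw [← Finset.card_union_of_disjoint]
  · congr 1
    ext j
    simp only [mem_PW, Finset.mem_union, Finset.mem_Icc, Finset.mem_insert]
    constructor
    · rintro ⟨b, rfl | hb, h1, h2⟩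
      · by_cases hj : j ≤ M'
        · left; exact ⟨M', hM', by omega, hj⟩
        · right; omega
      · left; exact ⟨b, hb, h1, h2⟩
    · rintro (⟨b, hb, h1, h2⟩ | h1)
      · exact ⟨b, Or.inr hb, h1, h2⟩
      · exact ⟨M, Or.inl rfl, by omega, by omega⟩
  · rw [Finset.disjoint_left]
    intro j hj
    obtain ⟨b, hb, h1, h2⟩ := mem_PW.1 hj
    have := hmax b hb
    simp only [Finset.mem_Icc]
    omega

lemma P1W_insert {k M M' : ℕ} {s : Finset ℕ} (hM' : M' ∈ s) (hmax : ∀ i ∈ s, i ≤ M') (h : M' < M) :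
    P1W k (insert M s) ⊆ (P1W k s) ∪ (Finset.Icc (max (M'+1) (M+1-k)) M) := by
  intro j
  simp only [mem_P1W, Finset.mem_union, Finset.mem_Icc, Finset.mem_insert]
  rintro ⟨⟨b, hb, h1, h2⟩, c, hc⟩
  by_cases hj : j ≤ M'
  · left
    refine ⟨?_, c, fun i hi => hc i (Or.inr hi)⟩
    rcases hb with rfl | hb
    · exact ⟨M', hM', by omega, hj⟩
    · exact ⟨b, hb, h1, h2⟩
  · right
    rcases hb with rfl | hb
    · omega
    · have := hmax b hb; omega

lemma wordInd (k : ℕ) (hk : 4 ≤ k) (W : Finset ℕ) : (∀ i ∈ W, k ≤ i) → ∀ b1 ∈ W, ∀ bw ∈ W,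
    (∀ i ∈ W, b1 ≤ i ∧ i ≤ bw) →
    (W.card + 2 * k - 2 ≤ (PW k W).card ∨ k + bw - b1 ≤ (PW k W).card) ∧
    (2 ≤ W.card → (P1W k W).card + 2 * W.card + 2 * k ≤ 2 * (PW k W).card + 4) := by
  induction W using Finset.induction_on_max with
  | empty => intro _ b1 hb1; simp at hb1
  | insert M s hs ih =>
    intro hge b1 hb1 bw hbw hall
    have hbw : bw = M := by
      have := (hall M (by simp)).2
      rcases Finset.mem_insert.1 hbw with h | h
      · exact h
      · have := hs bw h; omega
    subst hbw
    have hnot : bw ∉ s := fun h => lt_irrefl _ (hs _ h)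
    rcases s.eq_empty_or_nonempty with rfl | hne
    · have : b1 = bw := by simpa using hb1
      subst this
      have hkb := hge b1 (by simp)
      have : (PW k (insert b1 ∅)).card = k := by
        simp [PW]; omega
      rw [this]
      simp
    · set M' := s.max' hne with hM'
      have hM's : M' ∈ s := s.max'_mem hne
      have hmax : ∀ i ∈ s, i ≤ M' := fun i hi => s.le_max' i hi
      have hlt := hs M' hM's
      have hb1s : b1 ∈ s := by
        rcases Finset.mem_insert.1 hb1 with h | h
        · have := (hall M' (by simp [hM's])).1; omega
        · exact h
      have hkb := hge bw (by simp)
      have hkM := hge M' (by simp [hM's])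
      have hb1M := hmax _ hb1s
      obtain ⟨ih1, ih2⟩ := ih (fun i hi => hge i (by simp [hi])) b1 hb1s M' hM's
        (fun i hi => ⟨(hall i (by simp [hi])).1, hmax i hi⟩)
      have hP := PW_insert (k := k) hM's hmax hlt
      have hP1 := P1W_insert (k := k) hM's hmax hlt
      rw [Finset.card_insert_of_notMem hnot]
      have hc : (Finset.Icc (max (M'+1) (bw+1-k)) bw).card = min (bw - M') k := by
        rw [Nat.card_Icc]; omega
      rw [hP, hc]
      refine ⟨?_, ?_⟩
      · have : s.card ≤ M' + 1 - b1 := by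
          rw [← Nat.card_Icc]
          apply Finset.card_le_card
          intro i hi
          rw [Finset.mem_Icc]
          exact ⟨(hall i (by simp [hi])).1, hmax i hi⟩
        omega
      · intro _
        by_cases h2 : 2 ≤ s.card
        · have ih2 := ih2 h2
          have hle := Finset.card_le_card hP1
          have hu := Finset.card_union_le (P1W k s) (Finset.Icc (max (M'+1) (bw+1-k)) bw)
          by_cases hα : bw = M' + 1
          · have hmem : M' ∈ P1W k s := by
              rw [mem_P1W]
              refine ⟨⟨M', hM's, by omega, le_rfl⟩, M', fun i hi h1 _ => le_antisymm (hmax i hi) h1⟩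
            have hnm : M' ∉ P1W k (insert bw s) := by
              rw [mem_P1W]
              rintro ⟨-, b, hb⟩
              have e1 := hb M' (by simp [hM's]) le_rfl (by omega)
              have e2 := hb bw (by simp) (by omega) (by omega)
              omega
            have hsub : P1W k (insert bw s) ⊆ (P1W k s).erase M' ∪ (Finset.Icc (max (M'+1) (bw+1-k)) bw) := by
              intro j hj
              have hjm : j ≠ M' := by rintro rfl; exact hnm hj
              have := hP1 hj
              simp only [Finset.mem_union, Finset.mem_erase] at this ⊢
              tauto
            have hle := Finset.card_le_card hsub
            have hu := Finset.card_union_le ((P1W k s).erase M') (Finset.Icc (max (M'+1) (bw+1-k)) bw)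
            have := Finset.card_erase_of_mem hmem
            have : 0 < (P1W k s).card := Finset.card_pos.2 ⟨_, hmem⟩
            omega
          · omega
        · have hs1 : s.card = 1 := by
            have := Finset.card_pos.2 hne; omega
          obtain ⟨m, rfl⟩ := Finset.card_eq_one.1 hs1
          have hm : M' = m := by simpa using hM's
          have hps : (PW k {m}).card = k := by
            simp [PW]; omega
          have hsub : P1W k (insert bw {m}) ⊆ Finset.Icc (m+1-k) (min m (bw-k)) ∪ (Finset.Icc (max (M'+1) (bw+1-k)) bw) := by
            intro j hj
            have hj' := hP1 hj
            simp only [Finset.mem_union, Finset.mem_Icc] at hj' ⊢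
            rcases hj' with h | h
            · left
              rw [mem_P1W] at h hj
              obtain ⟨⟨b, hb, h1, h3⟩, -⟩ := h
              have hb : b = m := by simpa using hb
              subst hb
              obtain ⟨-, c, hc⟩ := hj
              have e1 := hc b (by simp) h3 (by omega)
              have : ¬ (bw < j + k) := fun hh => by
                have e2 := hc bw (by simp) (by omega) hh
                omega
              omega
            · right; exact h
          have hle := Finset.card_le_card hsub
          have hu := Finset.card_union_le (Finset.Icc (m+1-k) (min m (bw-k))) (Finset.Icc (max (M'+1) (bw+1-k)) bw)
          rw [hc] at hu
          have : (Finset.Icc (m+1-k) (min m (bw-k))).card ≤ min (bw - M') k := by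
            rw [Nat.card_Icc]; omega
          rw [hps, hs1]
          omega

lemma PW_sub {k t : ℕ} {W : Finset ℕ} (hW : W ⊆ Finset.Icc k (t-1)) : PW k W ⊆ Finset.Icc 1 (t-1) := by
  intro j hj
  obtain ⟨b, hb, h1, h2⟩ := mem_PW.1 hj
  have := Finset.mem_Icc.1 (hW hb)
  rw [Finset.mem_Icc]; omega

lemma word_aux (k t : ℕ)
   (ht : (k = 4 ∧ t = 8) ∨ (k = 5 ∧ t = 14) ∨ (6 ≤ k ∧ t = k^2)) : 2 * k ≤ t := by
  rcases ht with ⟨rfl, rfl⟩ | ⟨rfl, rfl⟩ | ⟨h, rfl⟩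
  · norm_num
  · norm_num
  · nlinarith

lemma num1 (k : ℤ) (h : 6 ≤ k) : (k^2 - 2*k+1) * 2 < 3 * (k - 1) * (k^2 - k - 4) := by
  obtain ⟨a, rfl⟩ : ∃ a, k = a + 6 := ⟨k - 6, by ring⟩
  have : 0 ≤ a := by linarith
  have : 0 ≤ a^2 := by positivity
  have : 0 ≤ a^3 := by positivity
  nlinarith

lemma num2 (k δ : ℤ) (h : 6 ≤ k) (hδ0 : 0 ≤ δ) : (k^2 - 2*k+1) * (2*δ) ≤ 3 * (k^2-k) * δ := by
  have : 0 ≤ (3 * (k^2-k) - 2 * (k^2 - 2*k+1)) * δ := by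
    apply mul_nonneg _ hδ0
    nlinarith
  linarith

set_option maxHeartbeats 1000000 in
/-- the main word lemma -/
lemma word (k t : ℕ) (hk : 4 ≤ k) 
    (ht : (k = 4 ∧ t = 8) ∨ (k = 5 ∧ t = 14) ∨ (6 ≤ k ∧ t = k^2))
    (W B : Finset ℕ) (hne : W.Nonempty) (hW : W ⊆ Finset.Icc k (t-1)) (hBP : B ⊆ PW k W)
    (hB : ∀ j ∈ B, ∃ b ∈ W, (∀ i ∈ W, j ≤ i → i < j + k → i = b) ∧ j ≤ b ∧ b < j + k ∧ 
      ((j ≠ b ∧ (j + k ∉ W ∨ j + k + 1 ∉ W)) ∨ (b + 1 ≠ j + k ∧ (j - 1 ∉ W ∨ j - 2 ∉ W)))) :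
    3 * ((t:ℤ)-1) * W.card + ((t:ℤ)-2*k+1) * B.card ≤ 3*((t:ℤ)-k) * (PW k W).card ∧
    (3 * ((t:ℤ)-1) * W.card + ((t:ℤ)-2*k+1) * B.card = 3*((t:ℤ)-k) * (PW k W).card → 
      W.card = t - k ∧ B.card = 0) := by
  have h2k := word_aux k t ht
  set b1 := W.min' hne with hb1
  set bw := W.max' hne with hbw
  have hb1W : b1 ∈ W := W.min'_mem hne
  have hbwW : bw ∈ W := W.max'_mem hne
  have hall : ∀ i ∈ W, b1 ≤ i ∧ i ≤ bw := fun i hi => ⟨W.min'_le i hi, W.le_max' i hi⟩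
  obtain ⟨hA, hC⟩ := wordInd k hk W (fun i hi => (Finset.mem_Icc.1 (hW hi)).1) b1 hb1W bw hbwW hall
  have hwspan : W.card ≤ bw + 1 - b1 := by
    rw [← Nat.card_Icc]
    exact Finset.card_le_card fun i hi => Finset.mem_Icc.2 (hall i hi)
  have hk1 := Finset.mem_Icc.1 (hW hb1W)
  have hkw := Finset.mem_Icc.1 (hW hbwW)
  have hpt : (PW k W).card ≤ t - 1 := by simpa using Finset.card_le_card (PW_sub hW)
  have hBP1 : B ⊆ P1W k W := by
    intro j hj
    obtain ⟨b, hb, h1, h2, h3, -⟩ := hB j hj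
    exact mem_P1W.2 ⟨⟨b, hb, by omega, h2⟩, b, h1⟩
  have hwpos : 1 ≤ W.card := Finset.card_pos.2 hne
  have hBp : B.card ≤ (PW k W).card := Finset.card_le_card hBP
  have hBp1 : B.card ≤ (P1W k W).card := Finset.card_le_card hBP1
  obtain ⟨δ, hδ⟩ : ∃ δ, (PW k W).card = W.card + k - 1 + δ := ⟨(PW k W).card - (W.card + k - 1), by omega⟩
  obtain ⟨r, hr⟩ : ∃ r, t = k + W.card + r := ⟨t - k - W.card, by omega⟩
  -- reduce to the slack form
  suffices hs : ((t:ℤ)-2*k+1) * B.card < 3*((t:ℤ)-k)*δ + 3*((k:ℤ)-1)*r ∨ (δ = 0 ∧ B.card = 0) by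
    have hid : 3*((t:ℤ)-k) * (PW k W).card - 3 * ((t:ℤ)-1) * W.card = 3*((t:ℤ)-k)*δ + 3*((k:ℤ)-1)*r := by
      have : ((PW k W).card : ℤ) = W.card + k - 1 + δ := by omega
      rw [this]
      have : (t:ℤ) = k + W.card + r := by exact_mod_cast hr
      rw [this]; ring
    have hk3 : (4:ℤ) ≤ k := by exact_mod_cast hk
    rcases hs with hs | ⟨h1, h2⟩
    · exact ⟨by linarith, fun h => by linarith⟩
    · rw [h1] at hid
      rw [h2]
      push_cast at hid ⊢
      refine ⟨by nlinarith, fun h => ⟨?_, trivial⟩⟩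
      have : (r:ℤ) = 0 := by nlinarith
      omega
  have hcw1 : W.card = 1 → B.card ≤ k ∧ δ = 0 := by
    intro h1
    obtain ⟨m, hm⟩ := Finset.card_eq_one.1 h1
    have : (PW k W).card = k := by
      have : k ≤ m := (Finset.mem_Icc.1 (hW (by simp [hm]))).1
      rw [hm]; simp [PW]; omega
    omega
  have hB2 : 2 ≤ W.card → B.card ≤ 2 * δ + 2 := by
    intro h; have := hC h; omega
  by_cases hw1 : W.card = 1
  · left
    obtain ⟨hb, rfl⟩ := hcw1 hw1
    have : ((t:ℤ)-2*k+1) * B.card ≤ ((t:ℤ)-2*k+1) * k := by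
      apply mul_le_mul_of_nonneg_left
      · exact_mod_cast hb
      · omega
    refine lt_of_le_of_lt this ?_
    have hr' : (r : ℤ) = t - k - 1 := by omega
    rw [hr']
    rcases ht with ⟨rfl, rfl⟩ | ⟨rfl, rfl⟩ | ⟨h, rfl⟩
    · norm_num
    · norm_num
    · push_cast
      have : (6:ℤ) ≤ k := by exact_mod_cast h
      nlinarith
  have hB2 := hB2 (by omega)
  have hbnd : ((t:ℤ)-2*k+1) * B.card ≤ ((t:ℤ)-2*k+1) * (2*δ+2) := by
      apply mul_le_mul_of_nonneg_left
      · exact_mod_cast hB2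
      · omega
  have hδ0 : (0:ℤ) ≤ δ := by positivity
  by_cases hsmall : W.card ≤ 4 ∧ ¬ (k = 4 ∧ W.card = 4)
  · left
    refine lt_of_le_of_lt hbnd ?_
    rcases ht with ⟨rfl, rfl⟩ | ⟨rfl, rfl⟩ | ⟨h, rfl⟩
    · have : 1 ≤ r := by omega
      have : (1:ℤ) ≤ r := by exact_mod_cast this
      push_cast; nlinarith
    · have : 5 ≤ r := by omega
      have : (5:ℤ) ≤ r := by exact_mod_cast this
      push_cast; nlinarith
    · have hr' : (k:ℤ)^2 - k - 4 ≤ r := by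
        have : ((k^2:ℕ):ℤ) = k + W.card + r := by exact_mod_cast hr
        push_cast at this
        have : (W.card:ℤ) ≤ 4 := by exact_mod_cast hsmall.1
        linarith
      push_cast
      have : (6:ℤ) ≤ k := by exact_mod_cast h
      have h1 : 3 * ((k:ℤ) - 1) * ((k:ℤ)^2 - k - 4) ≤ 3 * ((k:ℤ)-1) * r := by
        apply mul_le_mul_of_nonneg_left hr'
        linarith
      have h2 := num1 k this
      have h3 := num2 k δ this hδ0
      linarith
  have hw4 : 4 ≤ W.card := by omega
  have htk : (2*k:ℤ) ≤ t := by exact_mod_cast h2k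
  have hk4 : (4:ℤ) ≤ k := by exact_mod_cast hk
  have h3suf : 1 ≤ δ → B.card ≤ 3 * δ → ((t:ℤ)-2*k+1) * B.card < 3*((t:ℤ)-k)*δ + 3*((k:ℤ)-1)*r := by
    intro h1 h2
    have : ((t:ℤ)-2*k+1) * B.card ≤ ((t:ℤ)-2*k+1) * (3*δ) := by
      apply mul_le_mul_of_nonneg_left
      · exact_mod_cast h2
      · omega
    have h1 : (1:ℤ) ≤ δ := by exact_mod_cast h1
    have hr0 : 0 ≤ 3*((k:ℤ)-1)*r := by
      apply mul_nonneg <;> [linarith; positivity]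
    nlinarith
  by_cases hδ2 : 2 ≤ δ
  · left; exact h3suf (by omega) (by omega)
  have hspan : bw - b1 + 1 ≤ W.card + δ := by omega
  -- the two end windows
  have hj0P : b1 + 1 - k ∈ P1W k W := by
    rw [mem_P1W]
    exact ⟨⟨b1, hb1W, le_rfl, by omega⟩, b1, fun i hi h1 h2 => by have := (hall i hi).1; omega⟩
  have hj1P : bw ∈ P1W k W := by
    rw [mem_P1W]
    exact ⟨⟨bw, hbwW, by omega, le_rfl⟩, bw, fun i hi h1 h2 => by have := (hall i hi).2; omega⟩
  have hj01 : b1 + 1 - k ≠ bw := by omega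
  have hj0B : b1 + 1 - k ∈ B → b1 + 1 ∉ W ∨ b1 + 2 ∉ W := by
    intro h
    obtain ⟨b, hb, h1, h2, h3, h4⟩ := hB _ h
    have e := h1 b1 hb1W (by omega) (by omega)
    have a1 : b1 + 1 - k + k = b1 + 1 := by omega
    rw [a1] at h4
    rcases h4 with h4 | h4
    · exact h4.2
    · omega
  have hj1B : bw ∈ B → bw - 1 ∉ W ∨ bw - 2 ∉ W := by
    intro h
    obtain ⟨b, hb, h1, h2, h3, h4⟩ := hB _ h
    have e := h1 bw hbwW (by omega) (by omega)
    rcases h4 with h4 | h4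
    · omega
    · exact h4.2
  have hmiss : ∀ X : Finset ℕ, X ⊆ Finset.Icc b1 bw → Disjoint X W → X.card + W.card ≤ bw + 1 - b1 ∧ X.card ≤ δ := by
    intro X hX hd
    have h1 := Finset.card_le_card (Finset.union_subset hX (fun i hi => Finset.mem_Icc.2 (hall i hi) : W ⊆ Finset.Icc b1 bw))
    rw [Finset.card_union_of_disjoint hd, Nat.card_Icc] at h1
    exact ⟨h1, by omega⟩
  have hm0 : b1 + 1 - k ∈ B → ∃ y, y ∉ W ∧ b1 < y ∧ y ≤ b1 + 2 := by
    intro h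
    rcases hj0B h with h | h
    · exact ⟨_, h, by omega, by omega⟩
    · exact ⟨_, h, by omega, by omega⟩
  have hm1 : bw ∈ B → ∃ y, y ∉ W ∧ y < bw ∧ bw ≤ y + 2 := by
    intro h
    rcases hj1B h with h | h
    · exact ⟨_, h, by omega, by omega⟩
    · exact ⟨_, h, by omega, by omega⟩
  have hp1 : (P1W k W).card ≤ 2 * δ + 2 := by have := hC (by omega); omega
  have hmiss1 : ∀ y, y ∉ W → b1 ≤ y → y ≤ bw → 1 ≤ δ := by
    intro y hy h1 h2
    have := hmiss {y} (by simp; omega) (by simpa using hy)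
    simpa using this.2
  by_cases hδ0 : δ = 0
  · right
    refine ⟨hδ0, ?_⟩
    have n0 : b1 + 1 - k ∉ B := fun h => by
      obtain ⟨y, hy, h1, h2⟩ := hm0 h
      have := hmiss1 y hy (by omega) (by omega)
      omega
    have n1 : bw ∉ B := fun h => by
      obtain ⟨y, hy, h1, h2⟩ := hm1 h
      have := hmiss1 y hy (by omega) (by omega)
      omega
    have hsub : insert (b1+1-k) (insert bw B) ⊆ P1W k W := by
      intro j hj
      simp only [Finset.mem_insert] at hj
      rcases hj with rfl | rfl | hj
      · exact hj0P
      · exact hj1P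
      · exact hBP1 hj
    have := Finset.card_le_card hsub
    rw [Finset.card_insert_of_notMem (by simp [n0, hj01]), Finset.card_insert_of_notMem n1] at this
    omega
  · left
    have hδ1 : δ = 1 := by omega
    apply h3suf (by omega)
    by_contra hcon
    have n0 : b1 + 1 - k ∈ B := by
      by_contra n0
      have hsub : insert (b1+1-k) B ⊆ P1W k W := Finset.insert_subset hj0P hBP1
      have := Finset.card_le_card hsub
      rw [Finset.card_insert_of_notMem n0] at this
      omega
    have n1 : bw ∈ B := by
      by_contra n1
      have hsub : insert bw B ⊆ P1W k W := Finset.insert_subset hj1P hBP1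
      have := Finset.card_le_card hsub
      rw [Finset.card_insert_of_notMem n1] at this
      omega
    obtain ⟨y, hy, h1, h2⟩ := hm0 n0
    obtain ⟨z, hz, h3, h4⟩ := hm1 n1
    by_cases hw5 : W.card = 4
    · have hk4 : k = 4 := by omega
      omega
    · have hy1 := (hmiss {y} (by simp; omega) (by simpa using hy)).1
      rw [Finset.card_singleton] at hy1
      have hyz : y ≠ z := by omega
      have := hmiss {y, z} (by
        intro i hi
        simp only [Finset.mem_insert, Finset.mem_singleton] at hi
        rw [Finset.mem_Icc]; omega) (by
        rw [Finset.disjoint_left]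
        intro i hi
        simp only [Finset.mem_insert, Finset.mem_singleton] at hi
        rcases hi with rfl | rfl <;> assumption)
      rw [Finset.card_pair hyz] at this
      omega


lemma mem_vset {G : Finset (Finset ℕ)} {v : ℕ} : v ∈ vset G ↔ ∃ e ∈ G, v ∈ e := by
  simp [vset, Finset.mem_sup]

lemma K3plus_eq (k : ℕ) (hk : 4 ≤ k) : K3plus k =
    {(Finset.range (k+1)).erase 2, (Finset.range (k+1)).erase 1, (Finset.range (k+1)).erase 0} := by
  have h1 : ({0, 1} : Finset ℕ) ∪ (Finset.range (k + 1)).filter (fun x => 3 ≤ x) = (Finset.range (k+1)).erase 2 := by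
    ext i; simp; omega
  have h2 : ({0, 2} : Finset ℕ) ∪ (Finset.range (k + 1)).filter (fun x => 3 ≤ x) = (Finset.range (k+1)).erase 1 := by
    ext i; simp; omega
  have h3 : ({1, 2} : Finset ℕ) ∪ (Finset.range (k + 1)).filter (fun x => 3 ≤ x) = (Finset.range (k+1)).erase 0 := by
    ext i; simp; omega
  rw [K3plus, h1, h2, h3]

lemma vset_K3plus (k : ℕ) (hk : 4 ≤ k) : vset (K3plus k) = Finset.range (k+1) := by
  ext v
  rw [mem_vset, K3plus_eq k hk]
  simp
  omega

lemma image_erase' {f : ℕ → ℕ} {U : Finset ℕ} (hf : Set.InjOn f U) {i : ℕ} (hi : i ∈ U) :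
    (U.erase i).image f = (U.image f).erase (f i) := by
  ext v
  simp only [Finset.mem_image, Finset.mem_erase]
  constructor
  · rintro ⟨a, ⟨h1, h2⟩, rfl⟩
    exact ⟨fun h => h1 (hf h2 hi h), a, h2, rfl⟩
  · rintro ⟨h1, a, h2, rfl⟩
    exact ⟨a, ⟨fun h => h1 (by rw [h]), h2⟩, rfl⟩

lemma insert_er {Y : Finset ℕ} {a b : ℕ} (ha : a ∈ Y) (hab : a ≠ b) :
    insert a ((Y.erase a).erase b) = Y.erase b := by
  ext v
  simp only [Finset.mem_insert, Finset.mem_erase]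
  constructor
  · rintro (rfl | h)
    · exact ⟨hab, ha⟩
    · exact ⟨h.1, h.2.2⟩
  · rintro ⟨h1, h2⟩
    by_cases h : v = a
    · left; exact h
    · right; exact ⟨h1, h, h2⟩

lemma copyK3 (k : ℕ) (hk : 4 ≤ k) (G : Finset (Finset ℕ)) (hG : IsCopy (K3plus k) G) (e : Finset ℕ)
    (he : e ∈ G) : ∃ x a b, x ∉ e ∧ a ∈ e ∧ b ∈ e ∧ a ≠ b ∧
      G = {e, insert x (e.erase a), insert x (e.erase b)} ∧ vset G = insert x e := by
  obtain ⟨f, hf, rfl⟩ := hG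
  rw [vset_K3plus k hk] at hf
  have key : ∀ (Y : Finset ℕ) (x a b : ℕ), x ∈ Y → a ∈ Y → b ∈ Y → x ≠ a → x ≠ b → a ≠ b → 
     ∀ G' : Finset (Finset ℕ), G' = {Y.erase x, Y.erase a, Y.erase b} → 
     ∃ x' a' b', x' ∉ Y.erase x ∧ a' ∈ Y.erase x ∧ b' ∈ Y.erase x ∧ a' ≠ b' ∧
      G' = {Y.erase x, insert x' ((Y.erase x).erase a'), insert x' ((Y.erase x).erase b')} ∧ vset G' = insert x' (Y.erase x) := by
    intro Y x a b hx ha hb hxa hxb hab G' hG'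
    refine ⟨x, a, b, by simp, by simp [ha, hxa.symm], by simp [hb, hxb.symm], hab, ?_, ?_⟩
    · rw [insert_er hx hxa, insert_er hx hxb, hG']
    · ext v
      rw [mem_vset, hG', Finset.insert_erase hx]
      simp only [Finset.mem_insert, Finset.mem_singleton]
      constructor
      · rintro ⟨e, rfl | rfl | rfl, h⟩ <;> exact Finset.mem_of_mem_erase h
      · intro h
        by_cases hvx : v = x
        · exact ⟨Y.erase a, by simp, by simp [hvx, hxa]; exact hx⟩
        · exact ⟨Y.erase x, by simp, by simp [h, hvx]⟩
  have m : ∀ i ≤ 2, i ∈ Finset.range (k+1) := fun i hi => by simp; omega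
  have hinj : ∀ i ≤ 2, ∀ j ≤ 2, i ≠ j → f i ≠ f j := fun i hi j hj hij h => hij (hf (m i hi) (m j hj) h)
  rw [K3plus_eq k hk] at he ⊢
  rw [Finset.image_insert, Finset.image_insert, Finset.image_singleton, image_erase' hf (m 2 (by omega)),
    image_erase' hf (m 1 (by omega)), image_erase' hf (m 0 (by omega))] at he ⊢
  have mY : ∀ i ≤ 2, f i ∈ (Finset.range (k+1)).image f := fun i hi => Finset.mem_image_of_mem _ (m i hi)
  simp only [Finset.mem_insert, Finset.mem_singleton] at he
  rcases he with rfl | rfl | rfl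
  · exact key _ (f 2) (f 1) (f 0) (mY _ (by omega)) (mY _ (by omega)) (mY _ (by omega)) (hinj _ (by omega) _ (by omega) (by omega)) (hinj _ (by omega) _ (by omega) (by omega)) (hinj _ (by omega) _ (by omega) (by omega)) _ rfl
  · exact key _ (f 1) (f 2) (f 0) (mY _ (by omega)) (mY _ (by omega)) (mY _ (by omega)) (hinj _ (by omega) _ (by omega) (by omega)) (hinj _ (by omega) _ (by omega) (by omega)) (hinj _ (by omega) _ (by omega) (by omega)) _ (by ext; simp; tauto)
  · exact key _ (f 0) (f 2) (f 1) (mY _ (by omega)) (mY _ (by omega)) (mY _ (by omega)) (hinj _ (by omega) _ (by omega) (by omega)) (hinj _ (by omega) _ (by omega) (by omega)) (hinj _ (by omega) _ (by omega) (by omega)) _ (by ext; simp; tauto)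

/-- position `i` lies in window `j` -/
def inW (k t j i : ℕ) : Prop := (j ≤ i ∧ i < j + k) ∨ i + t < j + k

/-- window `j` under the labelling `c` -/
noncomputable def Ew (k t : ℕ) (c : ℕ → ℕ) (j : ℕ) : Finset ℕ :=
  ((Finset.range t).filter (fun i => inW k t j i)).image c

lemma mem_Ew {k t : ℕ} {c : ℕ → ℕ} {j v : ℕ} : v ∈ Ew k t c j ↔ ∃ i, i < t ∧ inW k t j i ∧ v = c i := by
  simp only [Ew, Finset.mem_image, Finset.mem_filter, Finset.mem_range]
  constructor
  · rintro ⟨i, ⟨h1, h2⟩, h3⟩; exact ⟨i, h1, h2, h3.symm⟩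
  · rintro ⟨i, h1, h2, h3⟩; exact ⟨i, ⟨h1, h2⟩, h3.symm⟩

lemma c_mem_Ew {k t : ℕ} {c : ℕ → ℕ} (hc : Set.InjOn c (Finset.range t)) {j i : ℕ} (hi : i < t) :
    c i ∈ Ew k t c j ↔ inW k t j i := by
  rw [mem_Ew]
  constructor
  · rintro ⟨i', h1, h2, h3⟩
    have := hc (by simpa using hi) (by simpa using h1) h3
    rwa [this]
  · intro h; exact ⟨i, hi, h, rfl⟩

lemma Ew_card {k t : ℕ} {c : ℕ → ℕ} (hc : Set.InjOn c (Finset.range t)) {j : ℕ} (hj : j < t) (hkt : 2 * k ≤ t) :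
    (Ew k t c j).card = k := by
  rw [Ew, Finset.card_image_of_injOn]
  · have : (Finset.range t).filter (fun i => inW k t j i) = Finset.Ico j (min t (j+k)) ∪ Finset.range (j+k-t) := by
      ext i
      rw [Finset.mem_filter]
      simp only [inW, Finset.mem_range, Finset.mem_union, Finset.mem_Ico]
      omega
    rw [this, Finset.card_union_of_disjoint]
    · simp; omega
    · rw [Finset.disjoint_left]; intro i; simp; omega
  · intro a ha b hb h
    exact hc (by simp at ha ⊢; exact ha.1) (by simp at hb ⊢; exact hb.1) h

lemma Ew_inj {k t : ℕ} {c : ℕ → ℕ} (hc : Set.InjOn c (Finset.range t)) (hk : 1 ≤ k) (hkt : 2 * k ≤ t)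
    {i j : ℕ} (hi : i < t) (hj : j < t) (h : Ew k t c i = Ew k t c j) : i = j := by
  have h1 : c i ∈ Ew k t c j := by rw [← h, c_mem_Ew hc hi]; left; omega
  have h2 : c j ∈ Ew k t c i := by rw [h, c_mem_Ew hc hj]; left; omega
  rw [c_mem_Ew hc hi] at h1
  rw [c_mem_Ew hc hj] at h2
  unfold inW at h1 h2
  omega

lemma mod_lt2 {a t : ℕ} (h : a < 2 * t) : a % t = if a < t then a else a - t := by
  split_ifs with h1
  · exact Nat.mod_eq_of_lt h1
  · rw [Nat.mod_eq_sub_mod (by omega), Nat.mod_eq_of_lt (by omega)]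

lemma vset_tightCycle {k t : ℕ} (hk : 1 ≤ k) : vset (tightCycle k t) = Finset.range t := by
  ext v
  simp only [mem_vset, tightCycle, cycEdge, Finset.mem_image, Finset.mem_range]
  constructor
  · rintro ⟨e, ⟨i, hi, rfl⟩, h⟩
    simp only [Finset.mem_image, Finset.mem_range] at h
    obtain ⟨j, hj, rfl⟩ := h
    exact Nat.mod_lt _ (by omega)
  · intro h
    refine ⟨_, ⟨v, h, rfl⟩, ?_⟩
    simp only [Finset.mem_image, Finset.mem_range]
    exact ⟨0, by omega, by simpa using Nat.mod_eq_of_lt h⟩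

lemma copyCycle {k t : ℕ} (hk : 1 ≤ k) (hkt : 2 * k ≤ t) {F2 : Finset (Finset ℕ)} (hF : IsCopy (tightCycle k t) F2)
    {e0 : Finset ℕ} (he : e0 ∈ F2) : ∃ c : ℕ → ℕ, Set.InjOn c (Finset.range t) ∧
      F2 = (Finset.range t).image (Ew k t c) ∧ e0 = Ew k t c 0 := by
  obtain ⟨f, hf, rfl⟩ := hF
  rw [vset_tightCycle hk] at hf
  obtain ⟨e, he1, rfl⟩ := Finset.mem_image.1 he
  obtain ⟨i0, hi0, rfl⟩ := Finset.mem_image.1 he1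
  rw [Finset.mem_range] at hi0
  have hE : ∀ j < t, Ew k t (fun j => f ((i0 + j) % t)) j = (cycEdge k t ((i0 + j) % t)).image f := by
    intro j hj
    ext v
    rw [mem_Ew]
    simp only [cycEdge, Finset.mem_image, Finset.mem_range]
    constructor
    · rintro ⟨i, hi, hw, rfl⟩
      refine ⟨_, ⟨if j ≤ i then i - j else i + t - j, ?_, rfl⟩, ?_⟩
      · unfold inW at hw; split_ifs <;> omega
      · congr 1
        rw [Nat.mod_add_mod]
        split_ifs with h
        · congr 1; omega
        · rw [show i0 + j + (i + t - j) = i0 + i + t by omega, Nat.add_mod_right]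
    · rintro ⟨_, ⟨l, hl, rfl⟩, rfl⟩
      rw [Nat.mod_add_mod]
      by_cases h : j + l < t
      · exact ⟨j + l, h, Or.inl (by omega), by rw [add_assoc]⟩
      · refine ⟨j + l - t, by omega, Or.inr (by omega), ?_⟩
        congr 1
        rw [show i0 + j + l = i0 + (j + l - t) + t by omega, Nat.add_mod_right]
  refine ⟨fun j => f ((i0 + j) % t), ?_, ?_, ?_⟩
  · intro a ha b hb h
    have ha : a < t := by simpa using ha
    have hb : b < t := by simpa using hb
    have := hf (by simpa using Nat.mod_lt _ (by omega)) (by simpa using Nat.mod_lt _ (by omega)) h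
    rw [mod_lt2 (by omega), mod_lt2 (by omega)] at this
    split_ifs at this <;> omega
  · ext e
    simp only [tightCycle, Finset.mem_image, Finset.mem_range]
    constructor
    · rintro ⟨_, ⟨i, hi, rfl⟩, rfl⟩
      refine ⟨(i + t - i0) % t, Nat.mod_lt _ (by omega), ?_⟩
      rw [hE _ (Nat.mod_lt _ (by omega)), Nat.add_mod_mod, show i0 + (i + t - i0) = i + t by omega, 
        Nat.add_mod_right, Nat.mod_eq_of_lt hi]
    · rintro ⟨j, hj, rfl⟩
      exact ⟨_, ⟨(i0 + j) % t, Nat.mod_lt _ (by omega), rfl⟩, (hE j hj).symm⟩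
  · rw [hE 0 (by omega)]; simp [Nat.mod_eq_of_lt hi0]

lemma vset_cyc {k t : ℕ} (hk : 1 ≤ k) (c : ℕ → ℕ) :
    vset ((Finset.range t).image (Ew k t c)) = (Finset.range t).image c := by
  ext v
  simp only [mem_vset, Finset.mem_image, Finset.mem_range]
  constructor
  · rintro ⟨_, ⟨i, hi, rfl⟩, h⟩
    obtain ⟨j, h1, h2, rfl⟩ := mem_Ew.1 h
    exact ⟨j, h1, rfl⟩
  · rintro ⟨i, hi, rfl⟩
    exact ⟨_, ⟨i, hi, rfl⟩, mem_Ew.2 ⟨i, hi, Or.inl (by omega), rfl⟩⟩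

/-- positions missing from `S` -/
noncomputable def Wl (t : ℕ) (c : ℕ → ℕ) (S : Finset ℕ) : Finset ℕ := (Finset.range t).filter (fun i => c i ∉ S)

lemma mem_Wl {t : ℕ} {c : ℕ → ℕ} {S : Finset ℕ} {i : ℕ} : i ∈ Wl t c S ↔ i < t ∧ c i ∉ S := by simp [Wl]

lemma Wl_sub {k t : ℕ} {c : ℕ → ℕ} {S : Finset ℕ} (h0 : Ew k t c 0 ⊆ S) : Wl t c S ⊆ Finset.Icc k (t-1) := by
  intro i hi
  rw [mem_Wl] at hi
  rw [Finset.mem_Icc]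
  by_contra h
  exact hi.2 (h0 (mem_Ew.2 ⟨i, hi.1, Or.inl (by omega), rfl⟩))

lemma hit_iff {k t : ℕ} {c : ℕ → ℕ} {S : Finset ℕ} (h0 : Ew k t c 0 ⊆ S)
    {j : ℕ} (hj : j < t) : ¬ Ew k t c j ⊆ S ↔ j ∈ PW k (Wl t c S) := by
  rw [mem_PW, Finset.not_subset]
  constructor
  · rintro ⟨v, hv, hvS⟩
    obtain ⟨i, h1, h2, rfl⟩ := mem_Ew.1 hv
    have hi : i ∈ Wl t c S := mem_Wl.2 ⟨h1, hvS⟩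
    have := Finset.mem_Icc.1 (Wl_sub h0 hi)
    refine ⟨i, hi, ?_⟩
    unfold inW at h2
    omega
  · rintro ⟨i, hi, h1, h2⟩
    have := Finset.mem_Icc.1 (Wl_sub h0 hi)
    rw [mem_Wl] at hi
    exact ⟨c i, mem_Ew.2 ⟨i, hi.1, Or.inl (by omega), rfl⟩, hi.2⟩

lemma PW_ge {k t : ℕ} (hk : 4 ≤ k) {W : Finset ℕ} (hW : W ⊆ Finset.Icc k (t-1)) (hne : W.Nonempty) :
    W.card + k ≤ (PW k W).card + 1 := by
  have hb1W := W.min'_mem hne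
  have hbwW := W.max'_mem hne
  have hall : ∀ i ∈ W, W.min' hne ≤ i ∧ i ≤ W.max' hne := fun i hi => ⟨W.min'_le i hi, W.le_max' i hi⟩
  have hA := (wordInd k hk W (fun i hi => (Finset.mem_Icc.1 (hW hi)).1) _ hb1W _ hbwW hall).1
  have hwspan : W.card ≤ W.max' hne + 1 - W.min' hne := by
    rw [← Nat.card_Icc]
    exact Finset.card_le_card fun i hi => Finset.mem_Icc.2 (hall i hi)
  have := (hall _ hb1W).2
  omega

lemma mk_cycle {k t : ℕ} (hk : 4 ≤ k) (hkt : 2 * k ≤ t) : mk k (tightCycle k t) = ((t:ℝ)-1)/((t:ℝ)-k) := by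
  have hk' : (4:ℝ) ≤ k := by exact_mod_cast hk
  have hkt' : 2 * (k:ℝ) ≤ t := by exact_mod_cast hkt
  have hpos : 0 < (t:ℝ) - k := by linarith
  have hone : 1 ≤ ((t:ℝ)-1)/((t:ℝ)-k) := by rw [le_div_iff₀ hpos]; linarith
  have hcopy : IsCopy (tightCycle k t) (tightCycle k t) := ⟨id, fun _ _ _ _ h => h, by
    have : (Finset.image (id : ℕ → ℕ)) = id := by funext x; simp
    rw [this, Finset.image_id]⟩
  have hne : (cycEdge k t 0) ∈ tightCycle k t := Finset.mem_image.2 ⟨0, by simp; omega, rfl⟩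
  have hcard : (tightCycle k t).card = t := by
    obtain ⟨c, hc, hF, -⟩ := copyCycle (by omega) hkt hcopy hne
    rw [hF, Finset.card_image_of_injOn]
    · simp
    · intro i hi j hj h
      exact Ew_inj hc (by omega) hkt (by simpa using hi) (by simpa using hj) h
  apply IsGreatest.csSup_eq
  constructor
  · refine ⟨_, subset_rfl, ?_⟩
    rw [dk, if_neg (by omega), if_neg (by omega), hcard, vcount, vset_tightCycle (by omega)]
    simp
  · rintro x ⟨H, hH, rfl⟩
    rw [dk]
    split_ifs with h1 h2
    · linarith
    · refine le_trans ?_ hone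
      rw [div_le_one (by linarith)]; linarith
    · obtain ⟨e0, he0⟩ : H.Nonempty := Finset.card_pos.1 (by omega)
      obtain ⟨c, hc, hF, hE0⟩ := copyCycle (by omega) hkt hcopy (hH he0)
      have h0 : Ew k t c 0 ⊆ vset H := by
        rw [← hE0]; intro v hv; exact mem_vset.2 ⟨_, he0, hv⟩
      have hsub : vset H ⊆ (Finset.range t).image c := by
        rw [← vset_cyc (k := k) (by omega), ← hF]
        intro v hv
        obtain ⟨e, he, hv⟩ := mem_vset.1 hv
        exact mem_vset.2 ⟨e, hH he, hv⟩
      have hVC : ((Finset.range t).image c).card = t := by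
        rw [Finset.card_image_of_injOn hc]; simp
      have hw : (Wl t c (vset H)).card + vcount H = t := by
        have e1 : (Wl t c (vset H)).image c = (Finset.range t).image c \ vset H := by
          ext v; simp [mem_Wl]; constructor
          · rintro ⟨i, ⟨h1, h2⟩, rfl⟩; exact ⟨⟨i, h1, rfl⟩, h2⟩
          · rintro ⟨⟨i, h1, rfl⟩, h2⟩; exact ⟨i, ⟨h1, h2⟩, rfl⟩
        have e2 := Finset.card_sdiff_add_card_eq_card hsub
        rw [← e1, Finset.card_image_of_injOn, hVC] at e2
        · exact e2
        · intro a ha b hb h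
          exact hc (by simpa using (mem_Wl.1 ha).1) (by simpa using (mem_Wl.1 hb).1) h
      rcases (Wl t c (vset H)).eq_empty_or_nonempty with hemp | hnon
      · rw [hemp] at hw
        have : vcount H = t := by simpa using hw
        rw [this]
        apply div_le_div_of_nonneg_right _ hpos.le
        have : H.card ≤ t := by rw [← hcard]; exact Finset.card_le_card hH
        have : (H.card:ℝ) ≤ t := by exact_mod_cast this
        linarith
      · have hge := PW_ge hk (Wl_sub h0) hnon
        have hHle : H.card + (PW k (Wl t c (vset H))).card ≤ t := by
          have hd : H ⊆ ((Finset.range t) \ (PW k (Wl t c (vset H)))).image (Ew k t c) := by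
            intro e he
            have := hH he
            rw [hF] at this
            obtain ⟨j, hj, rfl⟩ := Finset.mem_image.1 this
            refine Finset.mem_image.2 ⟨j, Finset.mem_sdiff.2 ⟨hj, ?_⟩, rfl⟩
            rw [← hit_iff h0 (by simpa using hj), not_not]
            intro v hv; exact mem_vset.2 ⟨_, he, hv⟩
          have h3 := (Finset.card_le_card hd).trans Finset.card_image_le
          have h4 := Finset.card_sdiff_add_card_eq_card (s := PW k (Wl t c (vset H))) (t := Finset.range t) (by
            refine (PW_sub (Wl_sub h0)).trans ?_
            intro i; simp; omega)
          rw [Finset.card_range] at h4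
          omega
        have hkv : k ≤ vcount H := by
          rw [vcount, ← Ew_card hc (j := 0) (by omega) hkt]
          exact Finset.card_le_card h0
        refine le_trans ?_ hone
        have hkv2 : k < vcount H := by
          rcases hkv.lt_or_eq with h | h
          · exact h
          · exfalso
            apply h2
            exact ⟨by omega, h.symm⟩
        have hkv3 : (k:ℝ) < vcount H := by exact_mod_cast hkv2
        rw [div_le_one (by linarith)]
        have : H.card + k ≤ vcount H + 1 := by omega
        have : (H.card:ℝ) + k ≤ vcount H + 1 := by exact_mod_cast this
        linarith

lemma mkA_val {k t : ℕ} (hk : 4 ≤ k) (hkt : 2 * k ≤ t) :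
    mkA k (K3plus k) (tightCycle k t) = 3 * ((t:ℝ)-1)/(2*(t:ℝ)-k-1) := by
  have hk' : (4:ℝ) ≤ k := by exact_mod_cast hk
  have hkt' : 2 * (k:ℝ) ≤ t := by exact_mod_cast hkt
  have hp1 : 0 < (t:ℝ) - 1 := by linarith
  have hp2 : 0 < 2*(t:ℝ)-k-1 := by linarith
  have hy : 1 / mk k (tightCycle k t) = ((t:ℝ)-k)/((t:ℝ)-1) := by rw [mk_cycle hk hkt, one_div_div]
  have hval : 3 * ((t:ℝ)-1)/(2*(t:ℝ)-k-1) = 3 / (1 + ((t:ℝ)-k)/((t:ℝ)-1)) := by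
    have : 1 + ((t:ℝ)-k)/((t:ℝ)-1) = (2*(t:ℝ)-k-1)/((t:ℝ)-1) := by
      field_simp; ring
    rw [this, div_div_eq_mul_div]
  have hyh : 1/2 ≤ ((t:ℝ)-k)/((t:ℝ)-1) := by
    rw [div_le_div_iff₀ (by norm_num) hp1]; linarith
  have hcard : (K3plus k).card = 3 := by
    rw [K3plus_eq k hk, Finset.card_eq_three]
    have ne : ∀ i j, i ≤ 2 → i ≠ j → (Finset.range (k+1)).erase i ≠ (Finset.range (k+1)).erase j := by
      intro i j hi hij h
      have : i ∈ (Finset.range (k+1)).erase j := by simp; omega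
      rw [← h] at this; simp at this
    exact ⟨_, _, _, ne _ _ (by omega) (by omega), ne _ _ (by omega) (by omega), ne _ _ (by omega) (by omega), rfl⟩
  have hunif : ∀ e ∈ K3plus k, e.card = k := by
    intro e he
    rw [K3plus_eq k hk] at he
    simp only [Finset.mem_insert, Finset.mem_singleton] at he
    rcases he with rfl | rfl | rfl <;> rw [Finset.card_erase_of_mem (by simp; try omega)] <;> simp
  rw [mkA, hy, hval]
  set y := ((t:ℝ)-k)/((t:ℝ)-1)
  apply IsGreatest.csSup_eq
  constructor
  · refine ⟨_, subset_rfl, Finset.card_pos.1 (by omega), ?_⟩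
    rw [hcard, vcount, vset_K3plus k hk]
    simp
  · rintro x ⟨H, hH, ⟨e, he⟩, rfl⟩
    have hc3 : H.card ≤ 3 := by rw [← hcard]; exact Finset.card_le_card hH
    have hev : e ⊆ vset H := fun v hv => mem_vset.2 ⟨e, he, hv⟩
    have hek := hunif e (hH he)
    have hkv : k ≤ vcount H := by
      rw [vcount, ← hek]; exact Finset.card_le_card hev
    have hkv' : (k:ℝ) ≤ vcount H := by exact_mod_cast hkv
    rw [div_le_div_iff₀ (by linarith) (by linarith)]
    by_cases h1 : H.card ≤ 1
    · have : (H.card:ℝ) ≤ 1 := by exact_mod_cast h1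
      nlinarith
    · have : k + 1 ≤ vcount H := by
        obtain ⟨e', he', hne⟩ := Finset.exists_mem_ne (s := H) (by omega) e
        by_contra hcon
        have e1 : e = vset H := Finset.eq_of_subset_of_card_le hev (by rw [hek]; unfold vcount at hcon; omega)
        have e2 : e' = vset H := Finset.eq_of_subset_of_card_le (fun v hv => mem_vset.2 ⟨e', he', hv⟩) (by rw [hunif e' (hH he')]; unfold vcount at hcon; omega)
        exact hne (e2.trans e1.symm)
      have : (k:ℝ) + 1 ≤ vcount H := by exact_mod_cast this
      have : (H.card:ℝ) ≤ 3 := by exact_mod_cast hc3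
      nlinarith


/-- special pairs -/
def spec (k t : ℕ) (c : ℕ → ℕ) (j x u : ℕ) : Prop := ∃ px pu, px < t ∧ pu < t ∧ x = c px ∧ u = c pu ∧
  ((pu = j ∧ (px = j+k ∨ px+t = j+k ∨ px = j+k+1 ∨ px+t = j+k+1)) ∨
   ((pu+1 = j+k ∨ pu+t+1 = j+k) ∧ (px+1 = j ∨ px+2 = j ∨ px+1 = j+t ∨ px+2 = j+t)))

lemma not_window {k t : ℕ} {c : ℕ → ℕ} (hc : Set.InjOn c (Finset.range t)) (hk : 4 ≤ k) (hkt : 2 * k ≤ t)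
    {i j x u : ℕ} (hj : j < t) (hi : i < t) (hx : x ∉ Ew k t c j) (hu : u ∈ Ew k t c j)
    (h : insert x ((Ew k t c j).erase u) = Ew k t c i) : spec k t c j x u := by
  have hxi : x ∈ Ew k t c i := by rw [← h]; simp
  obtain ⟨px, hpx, hix, rfl⟩ := mem_Ew.1 hxi
  rw [c_mem_Ew hc hpx] at hx
  have hui : u ∉ Ew k t c i := by
    rw [← h]; simp
    rintro rfl; exact hx ((c_mem_Ew hc hpx).1 hu)
  obtain ⟨pu, hpu, hju, rfl⟩ := mem_Ew.1 hu
  rw [c_mem_Ew hc hpu] at hui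
  have key : ∀ q, q < t → inW k t j q → ¬ inW k t i q → q = pu := by
    intro q hq h1 h2
    by_contra hne
    apply h2
    rw [← c_mem_Ew hc hq, ← h]
    refine Finset.mem_insert_of_mem (Finset.mem_erase.2 ⟨fun hh => hne (hc (by simpa using hq) (by simpa using hpu) hh), (c_mem_Ew hc hq).2 h1⟩)
  refine ⟨px, pu, hpx, hpu, rfl, rfl, ?_⟩
  have two : ∀ q1 q2, q1 < t → q2 < t → q1 ≠ q2 →
      inW k t j q1 → inW k t j q2 → ¬ inW k t i q1 → ¬ inW k t i q2 → False := by
    intro q1 q2 l1 l2 n1 a1 a2 b1 b2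
    exact n1 ((key q1 l1 a1 b1).trans (key q2 l2 a2 b2).symm)
  obtain ⟨ql, hql, hql'⟩ : ∃ q, q < t ∧ (q + 1 = j + k ∨ q + 1 + t = j + k) := by
    by_cases h : j + k ≤ t
    · exact ⟨j + k - 1, by omega, Or.inl (by omega)⟩
    · exact ⟨j + k - 1 - t, by omega, Or.inr (by omega)⟩
  obtain ⟨qm, hqm, hqm'⟩ : ∃ q, q < t ∧ (q + 2 = j + k ∨ q + 2 + t = j + k) := by
    by_cases h : j + k ≤ t + 1
    · exact ⟨j + k - 2, by omega, Or.inl (by omega)⟩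
    · exact ⟨j + k - 2 - t, by omega, Or.inr (by omega)⟩
  obtain ⟨qs, hqs, hqs'⟩ : ∃ q, q < t ∧ (q = j + 1 ∨ q + t = j + 1) := by
    by_cases h : j + 1 < t
    · exact ⟨j + 1, by omega, Or.inl (by omega)⟩
    · exact ⟨j + 1 - t, by omega, Or.inr (by omega)⟩
  have k1 := key j hj
  have k2 := key ql hql
  clear h key hxi hui hu
  unfold inW at *
  have hij : i ≠ j := by rintro rfl; exact hx hix
  have : i = j + 1 ∨ j = i + 1 ∨ (i = 0 ∧ j + 1 = t) ∨ (j = 0 ∧ i + 1 = t) := by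
    by_contra hcon
    clear k1 k2 hx hix hju
    by_cases c1 : j < i
    · by_cases c2 : i < j + k ∧ t < i + k
      · by_cases c3 : i + k ≤ j + t 
        · exact two j qs (by omega) (by omega) (by omega) (by omega) (by omega) (by omega) (by omega)
        · exact two ql qm (by omega) (by omega) (by omega) (by omega) (by omega) (by omega) (by omega)
      · by_cases c2 : i < j + k
        · exact two j qs (by omega) (by omega) (by omega) (by omega) (by omega) (by omega) (by omega)
        · exact two ql qm (by omega) (by omega) (by omega) (by omega) (by omega) (by omega) (by omega)
    · by_cases c2 : j < i + k
      · exact two ql qm (by omega) (by omega) (by omega) (by omega) (by omega) (by omega) (by omega)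
      · exact two j qs (by omega) (by omega) (by omega) (by omega) (by omega) (by omega) (by omega)
  clear two
  rcases this with rfl | rfl | ⟨rfl, h⟩ | ⟨rfl, h⟩
  · left; have := k1 (by omega) (by omega); omega
  · right; have := k2 (by omega) (by omega); omega
  · left; have := k1 (by omega) (by omega); omega
  · right; have := k2 (by omega) (by omega); omega

lemma dist2 {k t : ℕ} {c : ℕ → ℕ} (hc : Set.InjOn c (Finset.range t)) (hk : 4 ≤ k) (hkt : 2 * k ≤ t)
    {j j' x u x' u' : ℕ} (hjj : j < j') (hj : j' < t)
    (h : insert x ((Ew k t c j).erase u) = insert x' ((Ew k t c j').erase u')) : j' ≤ j + 2 ∨ j + t ≤ j' + 2 := by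
  have key : ∀ q, q < t → inW k t j q → ¬ inW k t j' q → c q = u ∨ c q = x' := by
    intro q hq h1 h2
    by_cases hu : c q = u
    · left; exact hu
    · right
      have : c q ∈ insert x ((Ew k t c j).erase u) := 
        Finset.mem_insert_of_mem (Finset.mem_erase.2 ⟨hu, (c_mem_Ew hc hq).2 h1⟩)
      rw [h, Finset.mem_insert] at this
      rcases this with h | h
      · exact h
      · exact absurd ((c_mem_Ew hc hq).1 (Finset.mem_of_mem_erase h)) h2
  by_contra hcon
  have three : ∀ q1 q2 q3, q1 < t → q2 < t → q3 < t → q1 ≠ q2 → q1 ≠ q3 → q2 ≠ q3 →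
      inW k t j q1 → inW k t j q2 → inW k t j q3 → ¬ inW k t j' q1 → ¬ inW k t j' q2 → ¬ inW k t j' q3 → False := by
    intro q1 q2 q3 l1 l2 l3 n1 n2 n3 a1 a2 a3 b1 b2 b3
    have i1 : c q1 ≠ c q2 := fun h => n1 (hc (by simpa using l1) (by simpa using l2) h)
    have i2 : c q1 ≠ c q3 := fun h => n2 (hc (by simpa using l1) (by simpa using l3) h)
    have i3 : c q2 ≠ c q3 := fun h => n3 (hc (by simpa using l2) (by simpa using l3) h)
    have := key q1 l1 a1 b1
    have := key q2 l2 a2 b2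
    have := key q3 l3 a3 b3
    omega
  unfold inW at three
  by_cases hd : j' < j + k
  · exact three j (j+1) (j+2) (by omega) (by omega) (by omega) (by omega) (by omega) (by omega)
      (by omega) (by omega) (by omega) (by omega) (by omega) (by omega)
  · exact three (j+k-1) (j+k-2) (j+k-3) (by omega) (by omega) (by omega) (by omega) (by omega) (by omega)
      (by omega) (by omega) (by omega) (by omega) (by omega) (by omega)

lemma triple {k t : ℕ} {c : ℕ → ℕ} (hc : Set.InjOn c (Finset.range t)) (hk : 4 ≤ k) (hkt : 2 * k ≤ t)
    {j1 j2 j3 x1 u1 x2 u2 x3 u3 : ℕ} (h0 : 1 ≤ j1) (h12 : j1 < j2) (h23 : j2 < j3) (h3 : j3 < t)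
    (e12 : insert x1 ((Ew k t c j1).erase u1) = insert x2 ((Ew k t c j2).erase u2))
    (e13 : insert x1 ((Ew k t c j1).erase u1) = insert x3 ((Ew k t c j3).erase u3)) :
    spec k t c j1 x1 u1 ∨ spec k t c j3 x3 u3 := by
  have d12 := dist2 hc hk hkt h12 (by omega) e12
  have d13 := dist2 hc hk hkt (by omega) (by omega) e13
  have d23 := dist2 hc hk hkt h23 (by omega) (e12.symm.trans e13)
  obtain rfl : j2 = j1 + 1 := by omega
  obtain rfl : j3 = j1 + 2 := by omega
  generalize hF : insert x1 ((Ew k t c j1).erase u1) = F at e12 e13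
  obtain ⟨qa, hqa, hqa'⟩ : ∃ q, q < t ∧ (q = j1 + k ∨ q + t = j1 + k) := by
    by_cases h : j1 + k < t
    · exact ⟨_, h, Or.inl rfl⟩
    · exact ⟨j1 + k - t, by omega, Or.inr (by omega)⟩
  obtain ⟨qb, hqb, hqb'⟩ : ∃ q, q < t ∧ (q = j1 + k + 1 ∨ q + t = j1 + k + 1) := by
    by_cases h : j1 + k + 1 < t
    · exact ⟨_, h, Or.inl rfl⟩
    · exact ⟨j1 + k + 1 - t, by omega, Or.inr (by omega)⟩
  have in1 : ∀ q, q < t → inW k t j1 q → c q ∉ F → u1 = c q := by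
    intro q hq h1 h2
    by_contra hne
    rw [← hF] at h2
    exact h2 (Finset.mem_insert_of_mem (Finset.mem_erase.2 ⟨Ne.symm hne, (c_mem_Ew hc hq).2 h1⟩))
  have in2 : ∀ q, q < t → inW k t (j1+1) q → c q ∉ F → u2 = c q := by
    intro q hq h1 h2
    by_contra hne
    rw [e12] at h2
    exact h2 (Finset.mem_insert_of_mem (Finset.mem_erase.2 ⟨Ne.symm hne, (c_mem_Ew hc hq).2 h1⟩))
  have in3 : ∀ q, q < t → inW k t (j1+2) q → c q ∉ F → u3 = c q := by
    intro q hq h1 h2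
    by_contra hne
    rw [e13] at h2
    exact h2 (Finset.mem_insert_of_mem (Finset.mem_erase.2 ⟨Ne.symm hne, (c_mem_Ew hc hq).2 h1⟩))
  have out1 : ∀ q, q < t → ¬ inW k t j1 q → c q ∈ F → x1 = c q := by
    intro q hq h1 h2
    rw [← hF, Finset.mem_insert] at h2
    rcases h2 with h2 | h2
    · exact h2.symm
    · exact absurd ((c_mem_Ew hc hq).1 (Finset.mem_of_mem_erase h2)) h1
  have out2 : ∀ q, q < t → ¬ inW k t (j1+1) q → c q ∈ F → x2 = c q := by
    intro q hq h1 h2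
    rw [e12, Finset.mem_insert] at h2
    rcases h2 with h2 | h2
    · exact h2.symm
    · exact absurd ((c_mem_Ew hc hq).1 (Finset.mem_of_mem_erase h2)) h1
  have out3 : ∀ q, q < t → ¬ inW k t (j1+2) q → c q ∈ F → x3 = c q := by
    intro q hq h1 h2
    rw [e13, Finset.mem_insert] at h2
    rcases h2 with h2 | h2
    · exact h2.symm
    · exact absurd ((c_mem_Ew hc hq).1 (Finset.mem_of_mem_erase h2)) h1
  have inj : ∀ p q, p < t → q < t → c p = c q → p = q := fun p q hp hq h => hc (by simpa using hp) (by simpa using hq) h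
  unfold inW at *
  by_cases hjF : c j1 ∈ F
  · right
    have ex3 := out3 j1 (by omega) (by omega) hjF
    have n1 : c (j1+1) ∉ F := fun hh => by
      have := out3 (j1+1) (by omega) (by omega) hh
      have := inj _ _ (by omega) (by omega) (ex3.symm.trans this)
      omega
    have ex2 := out2 j1 (by omega) (by omega) hjF
    have nb : c qb ∉ F := fun hh => by
      have := out2 qb (by omega) (by omega) hh
      have := inj _ _ (by omega) (by omega) (ex2.symm.trans this)
      omega
    have eu3 := in3 qb hqb (by omega) nb
    exact ⟨j1, qb, by omega, hqb, ex3, eu3, Or.inr ⟨by omega, by omega⟩⟩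
  · left
    have eu1 := in1 j1 (by omega) (by omega) hjF
    by_cases hb : c qb ∈ F
    · have := out1 qb hqb (by omega) hb
      exact ⟨qb, j1, hqb, by omega, this, eu1, Or.inl ⟨rfl, by omega⟩⟩
    · have eu3 := in3 qb hqb (by omega) hb
      have ha : c qa ∈ F := by
        by_contra ha
        have := in3 qa hqa (by omega) ha
        have := inj _ _ hqa hqb (this.symm.trans eu3)
        omega
      have := out1 qa hqa (by omega) ha
      exact ⟨qa, j1, hqa, by omega, this, eu1, Or.inl ⟨rfl, by omega⟩⟩

lemma picks {k t : ℕ} {c : ℕ → ℕ} (hc : Set.InjOn c (Finset.range t)) (hk : 4 ≤ k) (hkt : 2 * k ≤ t)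
    (T : Finset ℕ) (hT : T ⊆ Finset.Icc 1 (t-1)) (xs us : ℕ → ℕ) (hs : ∀ j ∈ T, ¬ spec k t c j (xs j) (us j)) :
    T.card ≤ 2 * (T.image (fun j => insert (xs j) ((Ew k t c j).erase (us j)))).card := by
  apply Finset.card_le_mul_card_image
  intro f hf
  by_contra hcon
  obtain ⟨X, hX, hX3⟩ := Finset.exists_subset_card_eq (show 3 ≤ _ by exact not_le.1 hcon)
  have o := X.orderEmbOfFin hX3
  have hmem : ∀ i, X.orderEmbOfFin hX3 i ∈ T ∧ insert (xs (X.orderEmbOfFin hX3 i)) ((Ew k t c (X.orderEmbOfFin hX3 i)).erase (us (X.orderEmbOfFin hX3 i))) = f := by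
    intro i
    exact Finset.mem_filter.1 (hX (Finset.orderEmbOfFin_mem X hX3 i))
  have l1 : X.orderEmbOfFin hX3 0 < X.orderEmbOfFin hX3 1 := (X.orderEmbOfFin hX3).strictMono (by decide)
  have l2 : X.orderEmbOfFin hX3 1 < X.orderEmbOfFin hX3 2 := (X.orderEmbOfFin hX3).strictMono (by decide)
  have m0 := Finset.mem_Icc.1 (hT (hmem 0).1)
  have m2 := Finset.mem_Icc.1 (hT (hmem 2).1)
  rcases triple hc hk hkt m0.1 l1 l2 (by omega) ((hmem 0).2.trans (hmem 1).2.symm) ((hmem 0).2.trans (hmem 2).2.symm) with h | h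
  · exact hs _ (hmem 0).1 h
  · exact hs _ (hmem 2).1 h

/-- the last vertex of window `j` -/
def isLast (k t : ℕ) (c : ℕ → ℕ) (j u : ℕ) : Prop := ∃ q, q < t ∧ u = c q ∧ (q + 1 = j + k ∨ q + 1 + t = j + k)

lemma share_ext {k t : ℕ} {c : ℕ → ℕ} (hc : Set.InjOn c (Finset.range t)) (hk : 4 ≤ k) (hkt : 2 * k ≤ t)
    {j j' x u u' : ℕ} (h0 : 1 ≤ j) (hjj : j < j') (hj : j' < t) (hx : ∀ q, q < t → c q ≠ x)
    (h : insert x ((Ew k t c j).erase u) = insert x ((Ew k t c j').erase u')) : isLast k t c j' u' := by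
  have key : ∀ q, q < t → inW k t j q → ¬ inW k t j' q → c q = u := by
    intro q hq h1 h2
    by_contra hu
    have : c q ∈ insert x ((Ew k t c j).erase u) := 
      Finset.mem_insert_of_mem (Finset.mem_erase.2 ⟨hu, (c_mem_Ew hc hq).2 h1⟩)
    rw [h, Finset.mem_insert] at this
    rcases this with h | h
    · exact hx q hq h
    · exact absurd ((c_mem_Ew hc hq).1 (Finset.mem_of_mem_erase h)) h2
  have two : ∀ q1 q2, q1 < t → q2 < t → q1 ≠ q2 → 
      inW k t j q1 → inW k t j q2 → ¬ inW k t j' q1 → ¬ inW k t j' q2 → False := by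
    intro q1 q2 l1 l2 n1 a1 a2 b1 b2
    exact n1 (hc (by simpa using l1) (by simpa using l2) ((key q1 l1 a1 b1).trans (key q2 l2 a2 b2).symm))
  have hj1 : j' = j + 1 := by
    by_contra hne
    unfold inW at two
    by_cases hd : j' < j + k
    · exact two j (j+1) (by omega) (by omega) (by omega) (by omega) (by omega) (by omega) (by omega)
    · exact two (j+k-1) (j+k-2) (by omega) (by omega) (by omega) (by omega) (by omega) (by omega) (by omega)
  subst hj1
  obtain ⟨q, hq, hq'⟩ : ∃ q, q < t ∧ (q = j + k ∨ q + t = j + k) := by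
    by_cases h : j + k < t
    · exact ⟨_, h, Or.inl rfl⟩
    · exact ⟨j + k - t, by omega, Or.inr (by omega)⟩
  refine ⟨q, hq, ?_, by omega⟩
  by_contra hne
  have : c q ∈ insert x ((Ew k t c (j+1)).erase u') := 
      Finset.mem_insert_of_mem (Finset.mem_erase.2 ⟨Ne.symm hne, (c_mem_Ew hc hq).2 (by unfold inW; omega)⟩)
  rw [← h, Finset.mem_insert] at this
  rcases this with h | h
  · exact hx q hq h
  · have := ((c_mem_Ew hc hq).1 (Finset.mem_of_mem_erase h))
    unfold inW at this; omega

lemma isLast_uniq {k t : ℕ} {c : ℕ → ℕ} {j u v : ℕ} (hu : isLast k t c j u) (hv : isLast k t c j v) : u = v := by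
  obtain ⟨q, h1, rfl, h2⟩ := hu
  obtain ⟨q', h1', rfl, h2'⟩ := hv
  have : q = q' := by omega
  rw [this]

lemma insert_erase_inj {e : Finset ℕ} {x u v : ℕ} (hx : x ∉ e) (hu : u ∈ e) 
    (h : insert x (e.erase u) = insert x (e.erase v)) : u = v := by
  by_contra hne
  have : u ∈ insert x (e.erase v) := Finset.mem_insert_of_mem (Finset.mem_erase.2 ⟨hne, hu⟩)
  rw [← h, Finset.mem_insert] at this
  rcases this with rfl | h
  · exact hx hu
  · simp at h

lemma star {k t : ℕ} {c : ℕ → ℕ} (hc : Set.InjOn c (Finset.range t)) (hk : 4 ≤ k) (hkt : 2 * k ≤ t)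
    (A : Finset ℕ) (hA : A ⊆ Finset.Icc 1 (t-1)) (hne : A.Nonempty) (x : ℕ) (hx : ∀ q, q < t → c q ≠ x)
    (us vs : ℕ → ℕ) (hu : ∀ j ∈ A, us j ∈ Ew k t c j) (hv : ∀ j ∈ A, vs j ∈ Ew k t c j)
    (huv : ∀ j ∈ A, us j ≠ vs j) (L : Finset (Finset ℕ)) 
    (hL1 : ∀ j ∈ A, insert x ((Ew k t c j).erase (us j)) ∈ L)
    (hL2 : ∀ j ∈ A, insert x ((Ew k t c j).erase (vs j)) ∈ L) : A.card + 1 ≤ L.card := by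
  have hxE : ∀ j, x ∉ Ew k t c j := by
    intro j h
    obtain ⟨q, h1, -, h2⟩ := mem_Ew.1 h
    exact hx q h1 h2.symm
  have hch : ∀ j, ∃ p q, j ∈ A → p ≠ q ∧ p ∈ Ew k t c j ∧ q ∈ Ew k t c j ∧ ¬ isLast k t c j p ∧ insert x ((Ew k t c j).erase p) ∈ L ∧ insert x ((Ew k t c j).erase q) ∈ L := by
    intro j
    by_cases hj : j ∈ A
    · by_cases hl : isLast k t c j (us j)
      · exact ⟨vs j, us j, fun _ => ⟨(huv j hj).symm, hv j hj, hu j hj, fun h => huv j hj (isLast_uniq hl h), hL2 j hj, hL1 j hj⟩⟩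
      · exact ⟨us j, vs j, fun _ => ⟨huv j hj, hu j hj, hv j hj, hl, hL1 j hj, hL2 j hj⟩⟩
    · exact ⟨0, 0, fun h => absurd h hj⟩
  choose p q hpq using hch
  set φ : ℕ → Finset ℕ := fun j => insert x ((Ew k t c j).erase (p j)) with hφ
  have hlt : ∀ j ∈ A, ∀ j' ∈ A, j < j' → ∀ u, insert x ((Ew k t c j).erase u) ≠ φ j' := by
    intro j hj j' hj' hjj u h
    have m := Finset.mem_Icc.1 (hA hj)
    have m' := Finset.mem_Icc.1 (hA hj')
    exact (hpq j' hj').2.2.2.1 (share_ext hc hk hkt m.1 hjj (by omega) hx h)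
  have hinj : Set.InjOn φ A := by
    intro a ha b hb h
    rcases lt_trichotomy a b with hh | hh | hh
    · exact absurd h (hlt a ha b hb hh _)
    · exact hh
    · exact absurd h.symm (hlt b hb a ha hh _)
  set m := A.min' hne
  have hm : m ∈ A := A.min'_mem hne
  have hnew : insert x ((Ew k t c m).erase (q m)) ∉ A.image φ := by
    intro h
    obtain ⟨j, hj, h⟩ := Finset.mem_image.1 h
    rcases (A.min'_le j hj).lt_or_eq with hh | hh
    · exact hlt m hm j hj hh _ h.symm
    · have hh : m = j := hh
      rw [← hh] at h
      exact (hpq m hm).1 (insert_erase_inj (hxE m) (hpq m hm).2.1 h)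
  have hsub : insert (insert x ((Ew k t c m).erase (q m))) (A.image φ) ⊆ L := by
    refine Finset.insert_subset (hpq m hm).2.2.2.2.2 ?_
    intro e he
    obtain ⟨j, hj, rfl⟩ := Finset.mem_image.1 he
    exact (hpq j hj).2.2.2.2.1
  have := Finset.card_le_card hsub
  rwa [Finset.card_insert_of_notMem hnew, Finset.card_image_of_injOn hinj] at this


/-- the badness condition on windows used in `word` -/
def badC (k : ℕ) (W : Finset ℕ) (j : ℕ) : Prop :=
  ∃ b ∈ W, (∀ i ∈ W, j ≤ i → i < j + k → i = b) ∧ j ≤ b ∧ b < j + k ∧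
    ((j ≠ b ∧ (j + k ∉ W ∨ j + k + 1 ∉ W)) ∨ (b + 1 ≠ j + k ∧ (j - 1 ∉ W ∨ j - 2 ∉ W)))

lemma bad1 {k t : ℕ} {c : ℕ → ℕ} (hc : Set.InjOn c (Finset.range t)) (hk : 4 ≤ k) (hkt : 2 * k ≤ t)
    {S : Finset ℕ} (h0 : Ew k t c 0 ⊆ S) {j x a b : ℕ} (hj1 : 1 ≤ j) (hjt : j < t)
    (ha : a ∈ Ew k t c j) (hab : a ≠ b) (hP : ¬ Ew k t c j ⊆ S)
    (h1 : insert x ((Ew k t c j).erase a) ⊆ S) (h2 : spec k t c j x b) : badC k (Wl t c S) j := by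
  have hW : ∀ i ∈ Wl t c S, k ≤ i ∧ i < t := fun i hi => by
    have := Finset.mem_Icc.1 (Wl_sub h0 hi); omega
  have hxS : x ∈ S := h1 (Finset.mem_insert_self _ _)
  have hE : ∀ v ∈ Ew k t c j, v ∉ S → v = a := by
    intro v hv hvS
    by_contra hne
    exact hvS (h1 (Finset.mem_insert_of_mem (Finset.mem_erase.2 ⟨hne, hv⟩)))
  obtain ⟨v, hv, hvS⟩ := Finset.not_subset.1 hP
  obtain rfl := hE v hv hvS
  obtain ⟨p, hp, hpj, rfl⟩ := mem_Ew.1 ha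
  have hpW : p ∈ Wl t c S := mem_Wl.2 ⟨hp, hvS⟩
  have hp2 := hW p hpW
  obtain ⟨px, pu, hpx, hpu, rfl, rfl, hs⟩ := h2
  have hpxW : px ∉ Wl t c S := fun h => (mem_Wl.1 h).2 hxS
  have hne : p ≠ pu := fun h => hab (by rw [h])
  unfold inW at hpj
  have nW : ∀ i, (i < k ∨ t ≤ i ∨ i = px) → i ∉ Wl t c S := by
    intro i hi h
    have := hW i h
    rcases hi with hi | hi | rfl
    · omega
    · omega
    · exact hpxW h
  refine ⟨p, hpW, ?_, by omega, by omega, ?_⟩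
  · intro i hi h3 h4
    have := hW i hi
    have h5 := mem_Wl.1 hi
    exact hc (by simpa using h5.1) (by simpa using hp) (hE (c i) ((c_mem_Ew hc h5.1).2 (Or.inl ⟨h3, h4⟩)) h5.2)
  · rcases hs with ⟨h3, h4⟩ | ⟨h3, h4⟩
    · left
      refine ⟨by omega, ?_⟩
      rcases h4 with h4 | h4 | h4 | h4
      · left; exact nW _ (by omega)
      · left; exact nW _ (by omega)
      · right; exact nW _ (by omega)
      · right; exact nW _ (by omega)
    · right
      refine ⟨by omega, ?_⟩
      rcases h4 with h4 | h4 | h4 | h4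
      · left; exact nW _ (by omega)
      · right; exact nW _ (by omega)
      · omega
      · right; exact nW _ (by omega)

lemma spec_uniq {k t : ℕ} {c : ℕ → ℕ} (hc : Set.InjOn c (Finset.range t)) (hk : 4 ≤ k) (hkt : 2 * k ≤ t)
    {j x a b : ℕ} (hjt : j < t) (h1 : spec k t c j x a) (h2 : spec k t c j x b) : a = b := by
  obtain ⟨px, pu, hpx, hpu, rfl, rfl, hs⟩ := h1
  obtain ⟨px', pu', hpx', hpu', hxx, rfl, hs'⟩ := h2
  obtain rfl := hc (by simpa using hpx) (by simpa using hpx') hxx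
  have : pu = pu' := by omega
  rw [this]

lemma bad_cond {k t : ℕ} {c : ℕ → ℕ} (hc : Set.InjOn c (Finset.range t)) (hk : 4 ≤ k) (hkt : 2 * k ≤ t)
    {S : Finset ℕ} (h0 : Ew k t c 0 ⊆ S) {j x a b : ℕ} (hj1 : 1 ≤ j) (hjt : j < t)
    (ha : a ∈ Ew k t c j) (hb : b ∈ Ew k t c j) (hab : a ≠ b) (hP : ¬ Ew k t c j ⊆ S)
    (h1 : insert x ((Ew k t c j).erase a) ⊆ S ∨ spec k t c j x a)
    (h2 : insert x ((Ew k t c j).erase b) ⊆ S ∨ spec k t c j x b) : badC k (Wl t c S) j := by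
  rcases h1 with h1 | h1 <;> rcases h2 with h2 | h2
  · exfalso
    apply hP
    intro v hv
    by_cases hva : v = a
    · exact h2 (Finset.mem_insert_of_mem (Finset.mem_erase.2 ⟨hva ▸ hab, hv⟩))
    · exact h1 (Finset.mem_insert_of_mem (Finset.mem_erase.2 ⟨hva, hv⟩))
  · exact bad1 hc hk hkt h0 hj1 hjt ha hab hP h1 h2
  · exact bad1 hc hk hkt h0 hj1 hjt hb hab.symm hP h2 h1
  · exact absurd (spec_uniq hc hk hkt hjt h1 h2) hab

/-- indices whose triangle apex is external and missing from `S` -/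
noncomputable def JX (t : ℕ) (c : ℕ → ℕ) (S : Finset ℕ) (xs : ℕ → ℕ) : Finset ℕ :=
  (Finset.Icc 1 (t-1)).filter (fun j => xs j ∉ (Finset.range t).image c ∧ xs j ∉ S)

lemma main_count {k t : ℕ} {c : ℕ → ℕ} (hc : Set.InjOn c (Finset.range t)) (hk : 4 ≤ k) (hkt : 2 * k ≤ t)
    {S : Finset ℕ} (h0 : Ew k t c 0 ⊆ S) (xs as bs : ℕ → ℕ) 
    (hx : ∀ j ∈ Finset.Icc 1 (t-1), xs j ∉ Ew k t c j)
    (ha : ∀ j ∈ Finset.Icc 1 (t-1), as j ∈ Ew k t c j)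
    (hb : ∀ j ∈ Finset.Icc 1 (t-1), bs j ∈ Ew k t c j)
    (hab : ∀ j ∈ Finset.Icc 1 (t-1), as j ≠ bs j) (Fst : Finset (Finset ℕ))
    (hF : ∀ f, f ∈ Fst ↔ (∃ j, j < t ∧ f = Ew k t c j) ∨ ∃ j ∈ Finset.Icc 1 (t-1),
      f = insert (xs j) ((Ew k t c j).erase (as j)) ∨ f = insert (xs j) ((Ew k t c j).erase (bs j))) :
    ∃ B ⊆ PW k (Wl t c S), (∀ j ∈ B, badC k (Wl t c S) j) ∧ ∃ n2 : ℕ,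
      (PW k (Wl t c S)).card ≤ (JX t c S xs).card + B.card + 2 * n2 ∧
      (PW k (Wl t c S)).card + n2 + (JX t c S xs).card + ((JX t c S xs).image xs).card ≤
        (Fst.filter (fun f => ¬ f ⊆ S)).card := by
  set P := PW k (Wl t c S) with hPdef
  set Q := JX t c S xs with hQdef
  set VC := (Finset.range t).image c with hVC
  have hPJ : P ⊆ Finset.Icc 1 (t-1) := PW_sub (Wl_sub h0)
  have hJt : ∀ j ∈ Finset.Icc 1 (t-1), 1 ≤ j ∧ j < t := fun j hj => by
    rw [Finset.mem_Icc] at hj; omega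
  have hEVC : ∀ j, Ew k t c j ⊆ VC := by
    intro j v hv
    obtain ⟨i, h1, -, rfl⟩ := mem_Ew.1 hv
    exact Finset.mem_image_of_mem _ (by simpa using h1)
  have hQ : ∀ j, j ∈ Q ↔ j ∈ Finset.Icc 1 (t-1) ∧ xs j ∉ VC ∧ xs j ∉ S := by
    intro j; rw [hQdef, JX, Finset.mem_filter]
  set good : ℕ → ℕ → Prop := fun j u => ¬ insert (xs j) ((Ew k t c j).erase u) ⊆ S ∧ ¬ spec k t c j (xs j) u with hgood
  set B := (P \ Q).filter (fun j => ¬ good j (as j) ∧ ¬ good j (bs j)) with hB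
  have hBP : B ⊆ P := (Finset.filter_subset _ _).trans Finset.sdiff_subset
  refine ⟨B, hBP, ?_, ?_⟩
  · intro j hj
    obtain ⟨h1, h2, h3⟩ := Finset.mem_filter.1 hj
    have hjJ := hPJ (hBP hj)
    have hjt := hJt j hjJ
    refine bad_cond hc hk hkt h0 hjt.1 hjt.2 (ha j hjJ) (hb j hjJ) (hab j hjJ) ((hit_iff h0 hjt.2).2 (hBP hj)) (x := xs j) ?_ ?_
    · simp only [hgood] at h2; tauto
    · simp only [hgood] at h3; tauto
  · set T := (P \ Q) \ B with hT
    have hTP : T ⊆ P \ Q := Finset.sdiff_subset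
    set us : ℕ → ℕ := fun j => if good j (as j) then as j else bs j with hus
    have husg : ∀ j ∈ T, good j (us j) ∧ (us j = as j ∨ us j = bs j) := by
      intro j hj
      have h1 := hTP hj
      have h2 := (Finset.mem_sdiff.1 hj).2
      rw [hB, Finset.mem_filter] at h2
      simp only [hus]
      split_ifs with h
      · exact ⟨h, Or.inl rfl⟩
      · refine ⟨?_, Or.inr rfl⟩
        by_contra h3
        exact h2 ⟨h1, h, h3⟩
    have hTJ : T ⊆ Finset.Icc 1 (t-1) := hTP.trans (Finset.sdiff_subset.trans hPJ)
    set E2 := T.image (fun j => insert (xs j) ((Ew k t c j).erase (us j))) with hE2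
    have hpick : T.card ≤ 2 * E2.card := picks hc hk hkt T hTJ xs us (fun j hj => (husg j hj).1.2)
    refine ⟨E2.card, ?_, ?_⟩
    · have e1 : P.card ≤ (P \ Q).card + Q.card := by
        have := Finset.card_le_card_sdiff_add_card (s := P) (t := Q); omega
      have e2 : (P \ Q).card ≤ T.card + B.card := by
        have := Finset.card_le_card_sdiff_add_card (s := P \ Q) (t := B); omega
      omega
    · set X3 := (Q.image xs).biUnion (fun x => Fst.filter (fun f => x ∈ f)) with hX3
      set X1 := P.image (Ew k t c) with hX1
      have hXout : ∀ x ∈ Q.image xs, x ∉ VC ∧ x ∉ S := by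
        intro x hx
        obtain ⟨j, hj, rfl⟩ := Finset.mem_image.1 hx
        exact ((hQ j).1 hj).2
      have hins : ∀ j u v, v ∈ insert (xs j) ((Ew k t c j).erase u) → v ∉ VC → v = xs j := by
        intro j u v hv hvc
        rcases Finset.mem_insert.1 hv with h | h
        · exact h
        · exact absurd (hEVC j (Finset.mem_of_mem_erase h)) hvc
      have hone : ∀ f ∈ Fst, ∀ v ∈ f, ∀ w ∈ f, v ∉ VC → w ∉ VC → v = w := by
        intro f hf v hv w hw hv' hw'
        rcases (hF f).1 hf with ⟨j, hj, rfl⟩ | ⟨j, hj, rfl | rfl⟩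
        · exact absurd (hEVC j hv) hv'
        · exact (hins _ _ _ hv hv').trans (hins _ _ _ hw hw').symm
        · exact (hins _ _ _ hv hv').trans (hins _ _ _ hw hw').symm
      have c1 : X1.card = P.card := by
        rw [hX1, Finset.card_image_of_injOn]
        intro i hi j hj h
        exact Ew_inj hc (by omega) hkt (hJt i (hPJ hi)).2 (hJt j (hPJ hj)).2 h
      have c3 : Q.card + (Q.image xs).card ≤ X3.card := by
        rw [hX3, Finset.card_biUnion]
        · have : Q.card + (Q.image xs).card = ∑ x ∈ Q.image xs, ((Q.filter (fun j => xs j = x)).card + 1) := by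
            rw [Finset.sum_add_distrib, ← Finset.card_eq_sum_card_image]; simp
          rw [this]
          apply Finset.sum_le_sum
          intro x hxx
          have hsub : Q.filter (fun j => xs j = x) ⊆ Finset.Icc 1 (t-1) := fun j hj =>
            ((hQ j).1 (Finset.mem_filter.1 hj).1).1
          apply star hc hk hkt _ hsub ?_ x ?_ as bs
          · intro j hj; exact ha j (hsub hj)
          · intro j hj; exact hb j (hsub hj)
          · intro j hj; exact hab j (hsub hj)
          · intro j hj
            have hh := (Finset.mem_filter.1 hj).2
            rw [Finset.mem_filter]
            refine ⟨(hF _).2 (Or.inr ⟨j, hsub hj, Or.inl (by rw [hh])⟩), by simp⟩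
          · intro j hj
            have hh := (Finset.mem_filter.1 hj).2
            rw [Finset.mem_filter]
            refine ⟨(hF _).2 (Or.inr ⟨j, hsub hj, Or.inr (by rw [hh])⟩), by simp⟩
          · obtain ⟨j, hj, h⟩ := Finset.mem_image.1 hxx
            exact ⟨j, Finset.mem_filter.2 ⟨hj, h⟩⟩
          · intro q hq h
            exact (hXout x hxx).1 (h ▸ Finset.mem_image_of_mem _ (by simpa using hq))
        · intro x hxx y hyy hne
          rw [Function.onFun, Finset.disjoint_left]
          intro f h1 h2
          rw [Finset.mem_filter] at h1 h2
          exact hne (hone f h1.1 x h1.2 y h2.2 (hXout x hxx).1 (hXout y hyy).1)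
      have hE2p : ∀ f ∈ E2, f ∈ Fst ∧ ¬ f ⊆ S ∧ (∀ i < t, f ≠ Ew k t c i) ∧ ∀ x ∈ Q.image xs, x ∉ f := by
        intro f hf
        obtain ⟨j, hj, rfl⟩ := Finset.mem_image.1 hf
        obtain ⟨⟨g1, g2⟩, g3⟩ := husg j hj
        have hjJ := hTJ hj
        refine ⟨(hF _).2 (Or.inr ⟨j, hjJ, ?_⟩), g1, ?_, ?_⟩
        · rcases g3 with g3 | g3 <;> simp [g3]
        · intro i hi h
          have hu : us j ∈ Ew k t c j := by
            rcases g3 with g3 | g3 <;> rw [g3]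
            · exact ha j hjJ
            · exact hb j hjJ
          exact g2 (not_window hc hk hkt (hJt j hjJ).2 hi (hx j hjJ) hu h)
        · intro x hxx hxf
          have h1 := hXout x hxx
          have h2 := hins _ _ _ hxf h1.1
          have h3 := (Finset.mem_sdiff.1 (hTP hj)).2
          exact h3 ((hQ j).2 ⟨hjJ, h2 ▸ h1.1, h2 ▸ h1.2⟩)
      have d12 : Disjoint X1 E2 := by
        rw [Finset.disjoint_left]
        intro f h1 h2
        obtain ⟨j, hj, rfl⟩ := Finset.mem_image.1 h1
        exact (hE2p _ h2).2.2.1 j (hJt j (hPJ hj)).2 rfl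
      have d123 : Disjoint (X1 ∪ E2) X3 := by
        rw [Finset.disjoint_left]
        intro f h1 h2
        obtain ⟨x, hxx, h3⟩ := Finset.mem_biUnion.1 h2
        have h3 := (Finset.mem_filter.1 h3).2
        rcases Finset.mem_union.1 h1 with h1 | h1
        · obtain ⟨j, hj, rfl⟩ := Finset.mem_image.1 h1
          exact (hXout x hxx).1 (hEVC j h3)
        · exact (hE2p _ h1).2.2.2 x hxx h3
      have hsub : (X1 ∪ E2) ∪ X3 ⊆ Fst.filter (fun f => ¬ f ⊆ S) := by
        intro f hf
        rw [Finset.mem_filter]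
        rcases Finset.mem_union.1 hf with hf | hf
        · rcases Finset.mem_union.1 hf with hf | hf
          · obtain ⟨j, hj, rfl⟩ := Finset.mem_image.1 hf
            have hjt := (hJt j (hPJ hj)).2
            exact ⟨(hF _).2 (Or.inl ⟨j, hjt, rfl⟩), (hit_iff h0 hjt).2 hj⟩
          · exact ⟨(hE2p f hf).1, (hE2p f hf).2.1⟩
        · obtain ⟨x, hxx, h3⟩ := Finset.mem_biUnion.1 hf
          rw [Finset.mem_filter] at h3
          exact ⟨h3.1, fun h => (hXout x hxx).2 (h h3.2)⟩
      have := Finset.card_le_card hsub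
      rw [Finset.card_union_of_disjoint d123, Finset.card_union_of_disjoint d12, c1] at this
      omega



lemma numfin (k t p n2 q r w b E : ℤ) (hk : 4 ≤ k) (hkt : 2 * k ≤ t) (h1 : p ≤ q + b + 2 * n2)
    (h2 : p + n2 + q + r ≤ E) (h3 : r ≤ q) (h4 : 0 ≤ n2)
    (hw : 3*(t-1)*w + (t-2*k+1)*b ≤ 3*(t-k)*p) :
    3*(t-1)*(w+r) ≤ (2*t-k-1)*E ∧ (3*(t-1)*(w+r) = (2*t-k-1)*E → n2 = 0 ∧ r = q ∧
      3*(t-1)*w + (t-2*k+1)*b = 3*(t-k)*p) := by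
  have e1 : 0 ≤ (2*t-k-1)*(E-p-n2-q-r) := mul_nonneg (by linarith) (by linarith)
  have e2 : 0 ≤ (t-2*k+1)*(q+b+2*n2-p) := mul_nonneg (by linarith) (by linarith)
  have e3 : 0 ≤ (3*k-4)*n2 := mul_nonneg (by linarith) (by linarith)
  have e4 : 0 ≤ (t+k-3)*(q-r) := mul_nonneg (by linarith) (by linarith)
  have id : (2*t-k-1)*E - 3*(t-1)*(w+r) = (2*t-k-1)*(E-p-n2-q-r) + (t-2*k+1)*(q+b+2*n2-p) +
    ((3*k-4)*n2 + n2) + ((t+k-3)*(q-r) + (q-r)) + (3*(t-k)*p - (3*(t-1)*w + (t-2*k+1)*b)) := by ring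
  refine ⟨by linarith, fun h => ⟨by linarith, by linarith, by linarith⟩⟩

lemma numfin0 (k t q r E : ℤ) (hkt : 2 * k ≤ t) (hk : 4 ≤ k) (h2 : q + r ≤ E) (h3 : r ≤ q) (h4 : 0 < r) :
    3*(t-1)*r < (2*t-k-1)*E := by
  have e1 : 0 ≤ (2*t-k-1)*(E-2*r) := mul_nonneg (by linarith) (by linarith)
  have e2 : 0 < (t-2*k+1)*r := mul_pos (by linarith) h4
  nlinarith

lemma tk_cases (k : ℕ) (hk : 4 ≤ k) :
    (k = 4 ∧ tk k = 8) ∨ (k = 5 ∧ tk k = 14) ∨ (6 ≤ k ∧ tk k = k^2) := by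
  unfold tk
  split_ifs with h1 h2
  · left; exact ⟨h1, rfl⟩
  · right; left; exact ⟨h2, rfl⟩
  · right; right; exact ⟨by omega, rfl⟩

set_option maxHeartbeats 1000000 in
lemma core {k t : ℕ} (hk : 4 ≤ k)
    (ht : (k = 4 ∧ t = 8) ∨ (k = 5 ∧ t = 14) ∨ (6 ≤ k ∧ t = k^2)) (hkt : 2 * k ≤ t)
    {Fst H : Finset (Finset ℕ)} (hH : H ⊆ Fst) (hV : vset H ⊂ vset Fst) {e0 : Finset ℕ} (he0 : e0 ∈ H)
    {F2' : Finset (Finset ℕ)} (he0F : e0 ∈ F2') (hcopy : IsCopy (tightCycle k t) F2')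
    {g : Finset ℕ → Finset (Finset ℕ)} (hg : ∀ e ∈ F2'.erase e0, IsCopy (K3plus k) (g e) ∧ e ∈ g e)
    (hFst : Fst = F2' ∪ (F2'.erase e0).biUnion g) :
    3*((t:ℤ)-1)*((vcount Fst : ℤ) - vcount H) ≤ (2*t-k-1)*((Fst.card : ℤ) - H.card) ∧
    (3*((t:ℤ)-1)*((vcount Fst : ℤ) - vcount H) = (2*t-k-1)*((Fst.card : ℤ) - H.card) →
      H = {e0} ∧ (∀ e ∈ F2'.erase e0, vset (g e) ∩ vset F2' = e) ∧
      (∀ e ∈ F2'.erase e0, ∀ e' ∈ F2'.erase e0, e ≠ e' →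
        (vset (g e) \ e) ∩ (vset (g e') \ e') = ∅)) := by
  have hk' : (4:ℤ) ≤ k := by exact_mod_cast hk
  have hkt' : 2 * (k:ℤ) ≤ t := by exact_mod_cast hkt
  have hex : ∀ e, ∃ x a b, e ∈ F2'.erase e0 → x ∉ e ∧ a ∈ e ∧ b ∈ e ∧ a ≠ b ∧
      g e = {e, insert x (e.erase a), insert x (e.erase b)} ∧ vset (g e) = insert x e := by
    intro e
    by_cases he : e ∈ F2'.erase e0
    · obtain ⟨x, a, b, h⟩ := copyK3 k hk (g e) (hg e he).1 e (hg e he).2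
      exact ⟨x, a, b, fun _ => h⟩
    · exact ⟨0, 0, 0, fun h => absurd h he⟩
  choose X A Bf hXAB using hex
  obtain ⟨c, hc, hF2, hE0⟩ := copyCycle (by omega) hkt hcopy he0F
  have hJt : ∀ j ∈ Finset.Icc 1 (t-1), 1 ≤ j ∧ j < t := fun j hj => by
    rw [Finset.mem_Icc] at hj; omega
  have hJmem : ∀ j ∈ Finset.Icc 1 (t-1), Ew k t c j ∈ F2'.erase e0 := by
    intro j hj
    have := hJt j hj
    rw [Finset.mem_erase, hE0, hF2]
    refine ⟨fun h => ?_, Finset.mem_image_of_mem _ (by simpa using this.2)⟩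
    have := Ew_inj hc (by omega) hkt this.2 (by omega) h
    omega
  have hmemJ : ∀ e ∈ F2'.erase e0, ∃ j ∈ Finset.Icc 1 (t-1), e = Ew k t c j := by
    intro e he
    rw [Finset.mem_erase, hF2] at he
    obtain ⟨j, hj, rfl⟩ := Finset.mem_image.1 he.2
    rw [Finset.mem_range] at hj
    refine ⟨j, ?_, rfl⟩
    rw [Finset.mem_Icc]
    have : j ≠ 0 := by rintro rfl; exact he.1 hE0.symm
    omega
  set xs : ℕ → ℕ := fun j => X (Ew k t c j) with hxs
  set as : ℕ → ℕ := fun j => A (Ew k t c j) with has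
  set bs : ℕ → ℕ := fun j => Bf (Ew k t c j) with hbs
  have hP := fun j hj => hXAB _ (hJmem j hj)
  have hF : ∀ f, f ∈ Fst ↔ (∃ j, j < t ∧ f = Ew k t c j) ∨ ∃ j ∈ Finset.Icc 1 (t-1),
      f = insert (xs j) ((Ew k t c j).erase (as j)) ∨ f = insert (xs j) ((Ew k t c j).erase (bs j)) := by
    intro f
    rw [hFst, Finset.mem_union, Finset.mem_biUnion]
    constructor
    · rintro (h | ⟨e, he, hf⟩)
      · rw [hF2] at h
        obtain ⟨j, hj, rfl⟩ := Finset.mem_image.1 h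
        exact Or.inl ⟨j, by simpa using hj, rfl⟩
      · obtain ⟨j, hj, rfl⟩ := hmemJ e he
        rw [(hP j hj).2.2.2.2.1] at hf
        simp only [Finset.mem_insert, Finset.mem_singleton] at hf
        rcases hf with hf | hf
        · exact Or.inl ⟨j, (hJt j hj).2, hf⟩
        · exact Or.inr ⟨j, hj, hf⟩
    · rintro (⟨j, hj, rfl⟩ | ⟨j, hj, hf⟩)
      · left; rw [hF2]; exact Finset.mem_image_of_mem _ (by simpa using hj)
      · right
        refine ⟨_, hJmem j hj, ?_⟩
        rw [(hP j hj).2.2.2.2.1]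
        simp only [Finset.mem_insert, Finset.mem_singleton]
        exact Or.inr hf
  set S := vset H with hS
  have hHS : ∀ f ∈ H, f ⊆ S := fun f hf v hv => mem_vset.2 ⟨f, hf, hv⟩
  have h0 : Ew k t c 0 ⊆ S := hE0 ▸ hHS e0 he0
  set VC := (Finset.range t).image c with hVC
  have hVCF2 : vset F2' = VC := by rw [hF2, vset_cyc (by omega)]
  have hEVC : ∀ j, Ew k t c j ⊆ VC := by
    intro j v hv
    obtain ⟨i, h1, -, rfl⟩ := mem_Ew.1 hv
    exact Finset.mem_image_of_mem _ (by simpa using h1)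
  have hVF : ∀ v, v ∈ vset Fst ↔ v ∈ VC ∨ ∃ j ∈ Finset.Icc 1 (t-1), v = xs j := by
    intro v
    rw [mem_vset]
    constructor
    · rintro ⟨f, hf, hv⟩
      rcases (hF f).1 hf with ⟨j, hj, rfl⟩ | ⟨j, hj, rfl | rfl⟩
      · exact Or.inl (hEVC j hv)
      · rcases Finset.mem_insert.1 hv with h | h
        · exact Or.inr ⟨j, hj, h⟩
        · exact Or.inl (hEVC j (Finset.mem_of_mem_erase h))
      · rcases Finset.mem_insert.1 hv with h | h
        · exact Or.inr ⟨j, hj, h⟩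
        · exact Or.inl (hEVC j (Finset.mem_of_mem_erase h))
    · rintro (h | ⟨j, hj, rfl⟩)
      · rw [← hVCF2, mem_vset] at h
        obtain ⟨e, he, hv⟩ := h
        exact ⟨e, by rw [hFst]; exact Finset.mem_union_left _ he, hv⟩
      · exact ⟨_, (hF _).2 (Or.inr ⟨j, hj, Or.inl rfl⟩), by simp⟩
  set Q := JX t c S xs with hQdef
  have hQ : ∀ j, j ∈ Q ↔ j ∈ Finset.Icc 1 (t-1) ∧ xs j ∉ VC ∧ xs j ∉ S := by
    intro j; rw [hQdef, JX, Finset.mem_filter]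
  have hQJ : Q ⊆ Finset.Icc 1 (t-1) := fun j hj => ((hQ j).1 hj).1
  set W := Wl t c S with hW
  have hWsub : W ⊆ Finset.Icc k (t-1) := Wl_sub h0
  have hvc : vcount Fst = vcount H + W.card + (Q.image xs).card := by
    have e1 : vset Fst \ S = W.image c ∪ Q.image xs := by
      ext v
      rw [Finset.mem_sdiff, hVF, Finset.mem_union]
      constructor
      · rintro ⟨h, hv⟩
        by_cases hvc : v ∈ VC
        · left
          obtain ⟨i, hi, rfl⟩ := Finset.mem_image.1 hvc
          exact Finset.mem_image_of_mem _ (mem_Wl.2 ⟨by simpa using hi, hv⟩)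
        · right
          rcases h with h | ⟨j, hj, rfl⟩
          · exact absurd h hvc
          · exact Finset.mem_image_of_mem _ ((hQ j).2 ⟨hj, hvc, hv⟩)
      · rintro (h | h)
        · obtain ⟨i, hi, rfl⟩ := Finset.mem_image.1 h
          have := mem_Wl.1 hi
          exact ⟨Or.inl (Finset.mem_image_of_mem _ (by simpa using this.1)), this.2⟩
        · obtain ⟨j, hj, rfl⟩ := Finset.mem_image.1 h
          have := (hQ j).1 hj
          exact ⟨Or.inr ⟨j, this.1, rfl⟩, this.2.2⟩
    have e2 := Finset.card_sdiff_add_card_eq_card hV.subset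
    have e3 : (W.image c).card = W.card := Finset.card_image_of_injOn (by
      intro a ha b hb h
      exact hc (by simpa using (mem_Wl.1 ha).1) (by simpa using (mem_Wl.1 hb).1) h)
    rw [e1, Finset.card_union_of_disjoint, e3] at e2
    · have e4 : vcount H = S.card := rfl
      have e5 : vcount Fst = (vset Fst).card := rfl
      omega
    · rw [Finset.disjoint_left]
      intro v h1 h2
      obtain ⟨i, hi, rfl⟩ := Finset.mem_image.1 h1
      obtain ⟨j, hj, h⟩ := Finset.mem_image.1 h2
      have h3 := ((hQ j).1 hj).2.1
      rw [h] at h3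
      exact h3 (Finset.mem_image_of_mem _ (by simpa using (mem_Wl.1 hi).1))
  have hvpos : vcount H < vcount Fst := Finset.card_lt_card hV
  have hcardE : H.card + (Fst.filter (fun f => ¬ f ⊆ S)).card ≤ Fst.card := by
    have := Finset.card_filter_add_card_filter_not (s := Fst) (fun f => f ⊆ S)
    have h2 : H.card ≤ (Fst.filter (fun f => f ⊆ S)).card :=
      Finset.card_le_card fun f hf => Finset.mem_filter.2 ⟨hH hf, hHS f hf⟩
    omega
  obtain ⟨B, hBP, hBbad, n2, hn1, hn2⟩ := main_count hc hk hkt h0 xs as bs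
    (fun j hj => (hP j hj).1) (fun j hj => (hP j hj).2.1) (fun j hj => (hP j hj).2.2.1) (fun j hj => (hP j hj).2.2.2.1) Fst hF
  rw [← hW] at hBP hBbad hn1 hn2
  rw [← hQdef] at hn1 hn2
  have hrq : (Q.image xs).card ≤ Q.card := Finset.card_image_le
  have hdiff : ((vcount Fst : ℤ) - vcount H) = (W.card : ℤ) + ((Q.image xs).card : ℤ) := by
    rw [hvc]; push_cast; ring
  rw [hdiff]
  rcases W.eq_empty_or_nonempty with hemp | hnon
  · have hr : 0 < (Q.image xs).card := by
      rw [hemp] at hvc; simp only [Finset.card_empty] at hvc; omega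
    have := numfin0 k t Q.card (Q.image xs).card ((Fst.card : ℤ) - H.card) hkt' hk' (by omega) (by omega) (by omega)
    rw [hemp]
    simp only [Finset.card_empty, Nat.cast_zero, zero_add]
    exact ⟨this.le, fun h => absurd h this.ne⟩
  · obtain ⟨w1, w2⟩ := word k t hk ht W B hnon hWsub hBP hBbad
    obtain ⟨f1, f2⟩ := numfin k t (PW k W).card n2 Q.card (Q.image xs).card W.card B.card ((Fst.card : ℤ) - H.card)
      hk' hkt' (by omega) (by omega) (by omega) (by omega) w1
    refine ⟨f1, fun heq => ?_⟩
    obtain ⟨g1, g2, g3⟩ := f2 heq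
    obtain ⟨w3, w4⟩ := w2 g3
    have hp : (PW k W).card = t - 1 := by
      rw [w3, w4] at g3
      have e : ((t - k : ℕ) : ℤ) = (t:ℤ) - k := by omega
      rw [e] at g3
      have : ((t:ℤ) - k) * (((PW k W).card : ℤ) - (t - 1)) = 0 := by
        push_cast at g3; linarith
      rcases mul_eq_zero.1 this with h | h <;> omega
    have hQall : Q = Finset.Icc 1 (t-1) := by
      apply Finset.eq_of_subset_of_card_le hQJ
      rw [Nat.card_Icc]; omega
    have hWall : W = Finset.Icc k (t-1) := by
      apply Finset.eq_of_subset_of_card_le hWsub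
      rw [Nat.card_Icc]; omega
    have hinj : Set.InjOn xs Q := Finset.card_image_iff.1 (by omega)
    have hSE : S ⊆ e0 := by
      intro v hv
      rcases (hVF v).1 (hV.subset hv) with h | ⟨j, hj, rfl⟩
      · obtain ⟨i, hi, rfl⟩ := Finset.mem_image.1 h
        rw [Finset.mem_range] at hi
        have : i ∉ W := fun hh => (mem_Wl.1 hh).2 hv
        rw [hWall, Finset.mem_Icc] at this
        rw [hE0, c_mem_Ew hc hi]
        left; omega
      · exact absurd hv ((hQ j).1 (hQall ▸ hj)).2.2
    have hcardk : ∀ f ∈ Fst, f.card = k := by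
      intro f hf
      rcases (hF f).1 hf with ⟨j, hj, rfl⟩ | ⟨j, hj, rfl | rfl⟩
      · exact Ew_card hc hj hkt
      · rw [Finset.card_insert_of_notMem (fun h => (hP j hj).1 (Finset.mem_of_mem_erase h)),
          Finset.card_erase_of_mem (hP j hj).2.1, Ew_card hc (hJt j hj).2 hkt]; omega
      · rw [Finset.card_insert_of_notMem (fun h => (hP j hj).1 (Finset.mem_of_mem_erase h)),
          Finset.card_erase_of_mem (hP j hj).2.2.1, Ew_card hc (hJt j hj).2 hkt]; omega
    refine ⟨?_, ?_, ?_⟩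
    · apply Finset.eq_singleton_iff_unique_mem.2 ⟨he0, ?_⟩
      intro f hf
      apply Finset.eq_of_subset_of_card_le ((hHS f hf).trans hSE)
      rw [hcardk f (hH hf), hcardk e0 (hH he0)]
    · intro e he
      obtain ⟨j, hj, rfl⟩ := hmemJ e he
      rw [(hP j hj).2.2.2.2.2, hVCF2, Finset.insert_inter_of_notMem, Finset.inter_eq_left.2 (hEVC j)]
      exact ((hQ j).1 (hQall ▸ hj)).2.1
    · intro e he e' he' hne
      obtain ⟨j, hj, rfl⟩ := hmemJ e he
      obtain ⟨j', hj', rfl⟩ := hmemJ e' he'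
      rw [(hP j hj).2.2.2.2.2, (hP j' hj').2.2.2.2.2]
      rw [Finset.eq_empty_iff_forall_notMem]
      intro v hv
      simp only [Finset.mem_inter, Finset.mem_sdiff, Finset.mem_insert] at hv
      have e1 : v = xs j := hv.1.1.resolve_right hv.1.2
      have e2 : v = xs j' := hv.2.1.resolve_right hv.2.2
      have : j = j' := hinj (by rw [hQall]; exact hj) (by rw [hQall]; exact hj') (e1.symm.trans e2)
      exact hne (by rw [this])

/-- the family `F*(K₃^{+k}, C_{t_k})` is asymmetric-balanced for all `k ≥ 4`. -/
theorem prop_c (k : ℕ) (hk : 4 ≤ k) :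
    AsymBalanced k (K3plus k) (tightCycle k (tk k)) := by
  intro Fst _ H hH hV hatt
  obtain ⟨e0, he0, hat⟩ := hatt
  have ht := tk_cases k hk
  generalize tk k = t at *
  have hkt := word_aux k t ht
  have hat' := hat
  obtain ⟨F2', he0F, hcopy, g, hg, hFst⟩ := hat'
  obtain ⟨c1, c2⟩ := core hk ht hkt hH hV he0 he0F hcopy hg hFst
  have hvpos : vcount H < vcount Fst := Finset.card_lt_card hV
  have hvpos' : (0:ℝ) < (vcount Fst : ℝ) - vcount H := by
    have : (vcount H : ℝ) < vcount Fst := by exact_mod_cast hvpos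
    linarith
  have hk' : (4:ℝ) ≤ k := by exact_mod_cast hk
  have hkt' : 2 * (k:ℝ) ≤ t := by exact_mod_cast hkt
  have hM : (0:ℝ) < 2*(t:ℝ)-k-1 := by linarith
  rw [mkA_val hk hkt]
  constructor
  · rw [div_le_div_iff₀ hM hvpos']
    have : 3*((t:ℝ)-1)*((vcount Fst : ℝ) - vcount H) ≤ (2*t-k-1)*((Fst.card : ℝ) - H.card) := by exact_mod_cast c1
    linarith
  · intro heq
    rw [div_eq_div_iff hvpos'.ne' hM.ne'] at heq
    have h3 : 3*((t:ℝ)-1)*((vcount Fst : ℝ) - vcount H) = (2*t-k-1)*((Fst.card : ℝ) - H.card) := by linarith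
    obtain ⟨d1, d2, d3⟩ := c2 (by exact_mod_cast h3)
    exact ⟨⟨e0, hat, d1⟩, F2', e0, he0F, hcopy, g, hg, hFst, d2, d3⟩


end ARR
end
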